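/- Let n be a positive integer, H = ℚ(ζ_n + ζ_n⁻¹), ℓ an odd prime with q ≡ 1 (mod ℓ) for some prime factor q of n, K_ℓ the degree-ℓ subfield of ℚ(ζ_q + ζ_q⁻¹), K_2 ⊆ H a real quadratic subfield, and K_{2ℓ} = K_2·K_ℓ. Assume the ℓ-class number of H is ℓ^m and the ℓ-class number of K_2 is ℓ^{m-1}. If the ℓ-class number of K_{2ℓ} is ℓ^{m-1} and ℓ ∤ [H : K_{2ℓ}], then the ℓ-rank of the class group of H equals 1 + r_{2,ℓ}, where r_{2,ℓ} is the ℓ-rank of the class group of K_2. -/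

import Mathlib

open NumberField IntermediateField Module
open scoped nonZeroDivisors

noncomputable section

namespace PaperStmt

/-- `ζ_n = exp(2πi/n)`, a primitive `n`-th root of unity (for `n > 0`). -/
def zetaC (n : ℕ) : ℂ := Complex.exp (2 * (Real.pi : ℂ) * Complex.I / n)

/-- The maximal real subfield `ℚ(ζ_n + ζ_n⁻¹)` of the cyclotomic field `ℚ(ζ_n)`. -/
def realCyclo (n : ℕ) : IntermediateField ℚ ℂ := ℚ⟮zetaC n + (zetaC n)⁻¹⟯

lemma isIntegral_of_pow_eq_one {x : ℂ} {k : ℕ} (hk : k ≠ 0) (h : x ^ k = 1) :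
    IsIntegral ℚ x :=
  ⟨Polynomial.X ^ k - Polynomial.C 1, Polynomial.monic_X_pow_sub_C 1 hk, by
    simp [h]⟩

lemma zetaC_pow (n : ℕ) (hn : n ≠ 0) : zetaC n ^ n = 1 := by
  have hn' : (n : ℂ) ≠ 0 := Nat.cast_ne_zero.mpr hn
  rw [zetaC, ← Complex.exp_nat_mul, mul_comm ((n : ℂ)), div_mul_cancel₀ _ hn',
    Complex.exp_two_pi_mul_I]

lemma isIntegral_zetaC_add_inv (n : ℕ) : IsIntegral ℚ (zetaC n + (zetaC n)⁻¹) := by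
  rcases eq_or_ne n 0 with h | h
  · have h1 : zetaC 0 = 1 := by simp [zetaC]
    subst h
    rw [h1, inv_one]
    exact isIntegral_one.add isIntegral_one
  · exact (isIntegral_of_pow_eq_one h (zetaC_pow n h)).add
      (isIntegral_of_pow_eq_one h (by rw [inv_pow, zetaC_pow n h, inv_one]))

instance (n : ℕ) : FiniteDimensional ℚ (realCyclo n) :=
  IntermediateField.adjoin.finiteDimensional (isIntegral_zetaC_add_inv n)

instance (E : IntermediateField ℚ ℂ) [FiniteDimensional ℚ E] : NumberField E := ⟨⟩

/-- The `p`-part (`p`-primary component / `p`-Sylow subgroup) of a commutative group. -/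
def pPart (G : Type*) [CommGroup G] (p : ℕ) (hp : p.Prime) : Subgroup G :=
  haveI : Fact p.Prime := ⟨hp⟩
  CommGroup.primaryComponent G p

/-- The `p`-class number: the order of the `p`-part. -/
def pCard (G : Type*) [CommGroup G] (p : ℕ) (hp : p.Prime) : ℕ :=
  Nat.card (pPart G p hp)

/-- The `p`-rank: `dim_{F_p} (G_p / G_p^p)`, read off as the exponent of `p`
in the order of the elementary abelian group `G_p / G_p^p`. -/
def pRank (G : Type*) [CommGroup G] (p : ℕ) (hp : p.Prime) : ℕ :=
  (Nat.card
    (↥(pPart G p hp) ⧸ (powMonoidHom p : ↥(pPart G p hp) →* ↥(pPart G p hp)).range)).factorization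
    p

/-- `t` is the homomorphism of class groups induced by extension of ideals along `F ⊆ K`:
it sends the class of a nonzero ideal `I` of `𝓞 F` to the class of `I · 𝓞 K`. -/
def IsClassGroupExtHom {F K : IntermediateField ℚ ℂ} [NumberField F] [NumberField K]
    (hFK : F ≤ K) (t : ClassGroup (𝓞 F) →* ClassGroup (𝓞 K)) : Prop :=
  ∀ (I : (Ideal (𝓞 F))⁰) (J : (Ideal (𝓞 K))⁰),
    Ideal.map (RingOfIntegers.mapRingHom (IntermediateField.inclusion hFK))
        (I : Ideal (𝓞 F)) = (J : Ideal (𝓞 K)) →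
    t (ClassGroup.mk0 I) = ClassGroup.mk0 J

/-- A smooth bump on the quadrants of the plane, homogeneous of degree `-2 s`. -/
def bump (ρ s x y : ℝ) : ℝ := |x * y| ^ (4 - s) / ((x ^ 4 + y ^ 4) * (x ^ 4 + ρ * y ^ 4))

lemma bump_nonneg {ρ : ℝ} (hρ : 1 ≤ ρ) (s x y : ℝ) : 0 ≤ bump ρ s x y := by
  unfold bump; positivity

lemma max_pow_four_le {ρ : ℝ} (hρ : 1 ≤ ρ) (x y : ℝ) :
    (max |x| |y|) ^ 4 ≤ x ^ 4 + ρ * y ^ 4 := by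
  have hx : 0 ≤ x ^ 4 := by positivity
  have hy : 0 ≤ y ^ 4 := by positivity
  have hx' : |x| ^ 4 = x ^ 4 := by rw [← abs_pow, abs_of_nonneg hx]
  have hy' : |y| ^ 4 = y ^ 4 := by rw [← abs_pow, abs_of_nonneg hy]
  rcases max_cases |x| |y| with h | h <;> rw [h.1] <;> nlinarith

lemma max_pow_eight_le {ρ : ℝ} (hρ : 1 ≤ ρ) (x y : ℝ) :
    (max |x| |y|) ^ 8 ≤ (x ^ 4 + y ^ 4) * (x ^ 4 + ρ * y ^ 4) := by
  have h1 := max_pow_four_le le_rfl x y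
  have h2 := max_pow_four_le hρ x y
  rw [one_mul] at h1
  calc (max |x| |y|) ^ 8 = (max |x| |y|) ^ 4 * (max |x| |y|) ^ 4 := by ring
    _ ≤ _ := by gcongr

lemma abs_mul_le_sq_max (x y : ℝ) : |x * y| ≤ (max |x| |y|) ^ 2 := by
  rw [abs_mul, sq]
  gcongr
  · exact le_max_left _ _
  · exact le_max_right _ _

lemma bump_le {ρ : ℝ} (hρ : 1 ≤ ρ) {s x y : ℝ} (hs : s ≤ 2) (h : 0 < max |x| |y|) :
    bump ρ s x y ≤ (max |x| |y|) ^ (-(2 * s)) := by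
  unfold bump
  set m := max |x| |y| with hm
  have h8 : 0 < m ^ 8 := by positivity
  calc _ ≤ (m ^ 2) ^ (4 - s) / m ^ 8 := by
        gcongr
        · linarith
        · exact abs_mul_le_sq_max x y
        · exact max_pow_eight_le hρ x y
    _ = m ^ (-(2 * s)) := by
        rw [← Real.rpow_natCast, ← Real.rpow_mul h.le, ← Real.rpow_natCast m 8, ← Real.rpow_sub h]
        congr 1; push_cast; ring

lemma abs_rpow_sub_rpow_le {p u v b : ℝ} (hp : 1 ≤ p) (hu : 0 ≤ u) (hv : 0 ≤ v)
    (hub : u ≤ b) (hvb : v ≤ b) : |u ^ p - v ^ p| ≤ p * b ^ (p - 1) * |u - v| := by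
  have := Convex.norm_image_sub_le_of_norm_hasDerivWithin_le (f := fun x : ℝ => x ^ p)
    (f' := fun x => p * x ^ (p - 1)) (C := p * b ^ (p - 1)) (s := Set.Icc 0 b) (x := v) (y := u)
    (fun x _ => (Real.hasDerivAt_rpow_const (Or.inr hp)).hasDerivWithinAt)
    (fun x hx => by
      rw [Real.norm_eq_abs, abs_of_nonneg (mul_nonneg (by linarith) (Real.rpow_nonneg hx.1 _))]
      gcongr
      · exact hx.1
      · exact hx.2) (convex_Icc 0 b) ⟨hv, hvb⟩ ⟨hu, hub⟩
  simpa [Real.norm_eq_abs] using this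

lemma abs_pow_four_sub_le {x y M B : ℝ} (hM : 0 ≤ M) (hx : |x| ≤ 2 * M) (hy : |y| ≤ 2 * M)
    (h : |x - y| ≤ B) : |x ^ 4 - y ^ 4| ≤ 32 * M ^ 3 * B := by
  have e : x ^ 4 - y ^ 4 = (x - y) * (x ^ 3 + x ^ 2 * y + x * y ^ 2 + y ^ 3) := by ring
  have hB : 0 ≤ B := (abs_nonneg _).trans h
  rw [e, abs_mul]
  have : |x ^ 3 + x ^ 2 * y + x * y ^ 2 + y ^ 3| ≤ 32 * M ^ 3 := by
    calc _ ≤ |x ^ 3| + |x ^ 2 * y| + |x * y ^ 2| + |y ^ 3| :=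
          (abs_add_le _ _).trans (by gcongr; exact abs_add_three _ _ _)
      _ = |x| ^ 3 + |x| ^ 2 * |y| + |x| * |y| ^ 2 + |y| ^ 3 := by
          simp only [abs_mul, abs_pow]
      _ ≤ (2 * M) ^ 3 + (2 * M) ^ 2 * (2 * M) + (2 * M) * (2 * M) ^ 2 + (2 * M) ^ 3 := by gcongr
      _ = 32 * M ^ 3 := by ring
  calc _ ≤ B * (32 * M ^ 3) := by gcongr
    _ = _ := by ring

lemma pow_four_le_of_abs_le {x b : ℝ} (h : |x| ≤ b) : x ^ 4 ≤ b ^ 4 := by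
  have : x ^ 4 = |x| ^ 4 := by rw [← abs_pow, abs_of_nonneg (by positivity)]
  rw [this]; gcongr

lemma abs_bump_sub_le {ρ : ℝ} (hρ : 1 ≤ ρ) {s x y x' y' B M : ℝ} (hs1 : 1 ≤ s) (hs2 : s ≤ 2)
    (hM : M = max |x| |y|) (hM1 : 1 ≤ M) (hB : 2 * B ≤ M) (hx : |x' - x| ≤ B)
    (hy : |y' - y| ≤ B) :
    |bump ρ s x' y' - bump ρ s x y| ≤ (100000000 * ρ) * B / M ^ 3 := by
  have hB0 : 0 ≤ B := (abs_nonneg _).trans hx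
  have hxM : |x| ≤ M := hM ▸ le_max_left _ _
  have hyM : |y| ≤ M := hM ▸ le_max_right _ _
  have hx'M : |x'| ≤ 2 * M := by
    have := abs_add_le x (x' - x); rw [add_sub_cancel] at this; linarith
  have hy'M : |y'| ≤ 2 * M := by
    have := abs_add_le y (y' - y); rw [add_sub_cancel] at this; linarith
  have hM' : M / 2 ≤ max |x'| |y'| := by
    rcases max_cases |x| |y| with h | h
    · have := abs_sub_abs_le_abs_sub x x'
      rw [abs_sub_comm x x'] at this
      exact le_trans (by rw [hM, h.1]; rw [hM, h.1] at hB; linarith) (le_max_left _ _)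
    · have := abs_sub_abs_le_abs_sub y y'
      rw [abs_sub_comm y y'] at this
      exact le_trans (by rw [hM, h.1]; rw [hM, h.1] at hB; linarith) (le_max_right _ _)
  have hD : M ^ 8 ≤ (x ^ 4 + y ^ 4) * (x ^ 4 + ρ * y ^ 4) := hM ▸ max_pow_eight_le hρ x y
  have hD' : M ^ 8 / 256 ≤ (x' ^ 4 + y' ^ 4) * (x' ^ 4 + ρ * y' ^ 4) := by
    refine le_trans ?_ (max_pow_eight_le hρ x' y')
    calc M ^ 8 / 256 = (M / 2) ^ 8 := by ring
      _ ≤ _ := by gcongr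
  have hM0 : 0 < M := by linarith
  have hu : |x * y| ≤ 4 * M ^ 2 := by
    rw [abs_mul]
    calc |x| * |y| ≤ M * M := by gcongr
      _ ≤ 4 * M ^ 2 := by nlinarith
  have hu' : |x' * y'| ≤ 4 * M ^ 2 := by
    rw [abs_mul]
    calc |x'| * |y'| ≤ (2 * M) * (2 * M) := by gcongr
      _ = 4 * M ^ 2 := by ring
  have huu : |(|x' * y'| - |x * y|)| ≤ 3 * M * B := by
    refine (abs_abs_sub_abs_le_abs_sub _ _).trans ?_
    have e : x' * y' - x * y = (x' - x) * y' + x * (y' - y) := by ring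
    rw [e]
    refine (abs_add_le _ _).trans ?_
    rw [abs_mul, abs_mul]
    calc _ ≤ B * (2 * M) + M * B := by gcongr
      _ = _ := by ring
  have h4M : 1 ≤ 4 * M ^ 2 := by nlinarith
  have hN : |(|x' * y'| ^ (4 - s) - |x * y| ^ (4 - s))| ≤ 144 * M ^ 5 * B := by
    refine (abs_rpow_sub_rpow_le (by linarith) (abs_nonneg _) (abs_nonneg _) hu' hu).trans ?_
    calc (4 - s) * (4 * M ^ 2) ^ (4 - s - 1) * |(|x' * y'| - |x * y|)|
        ≤ 3 * (4 * M ^ 2) ^ (2 : ℝ) * (3 * M * B) := by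
          gcongr
          · linarith
          · linarith
      _ = 144 * M ^ 5 * B := by
          rw [Real.rpow_two]; ring
  have hN' : |x' * y'| ^ (4 - s) ≤ 64 * M ^ 6 := by
    calc _ ≤ (4 * M ^ 2) ^ (4 - s) := by gcongr; linarith
      _ ≤ (4 * M ^ 2) ^ (3 : ℝ) := by gcongr; linarith
      _ = 64 * M ^ 6 := by norm_cast; ring
  have ex := abs_pow_four_sub_le hM0.le hx'M (hxM.trans (by linarith)) hx
  have ey := abs_pow_four_sub_le hM0.le hy'M (hyM.trans (by linarith)) hy
  have fx : x' ^ 4 ≤ 16 * M ^ 4 := (pow_four_le_of_abs_le hx'M).trans (by ring_nf; rfl)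
  have fy : y' ^ 4 ≤ 16 * M ^ 4 := (pow_four_le_of_abs_le hy'M).trans (by ring_nf; rfl)
  have gx : x ^ 4 ≤ M ^ 4 := pow_four_le_of_abs_le hxM
  have gy : y ^ 4 ≤ M ^ 4 := pow_four_le_of_abs_le hyM
  have hDD : |(x' ^ 4 + y' ^ 4) * (x' ^ 4 + ρ * y' ^ 4) - (x ^ 4 + y ^ 4) * (x ^ 4 + ρ * y ^ 4)|
      ≤ 2200 * ρ * M ^ 7 * B := by
    have e : (x' ^ 4 + y' ^ 4) * (x' ^ 4 + ρ * y' ^ 4) - (x ^ 4 + y ^ 4) * (x ^ 4 + ρ * y ^ 4) =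
      (x' ^ 4 + y' ^ 4) * ((x' ^ 4 - x ^ 4) + ρ * (y' ^ 4 - y ^ 4)) +
      ((x' ^ 4 - x ^ 4) + (y' ^ 4 - y ^ 4)) * (x ^ 4 + ρ * y ^ 4) := by ring
    have h1 : |(x' ^ 4 - x ^ 4) + ρ * (y' ^ 4 - y ^ 4)| ≤ 64 * ρ * M ^ 3 * B := by
      refine (abs_add_le _ _).trans ?_
      rw [abs_mul, abs_of_nonneg (by linarith : 0 ≤ ρ)]
      calc _ ≤ 32 * M ^ 3 * B + ρ * (32 * M ^ 3 * B) := by gcongr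
        _ ≤ ρ * (32 * M ^ 3 * B) + ρ * (32 * M ^ 3 * B) := by
          gcongr ?_ + _; exact le_mul_of_one_le_left (by positivity) hρ
        _ = _ := by ring
    have h2 : |(x' ^ 4 - x ^ 4) + (y' ^ 4 - y ^ 4)| ≤ 64 * M ^ 3 * B := by
      refine (abs_add_le _ _).trans ?_
      linarith
    have h3 : |x' ^ 4 + y' ^ 4| ≤ 32 * M ^ 4 := by
      rw [abs_of_nonneg (by positivity)]; linarith
    have h4 : |x ^ 4 + ρ * y ^ 4| ≤ 2 * ρ * M ^ 4 := by
      rw [abs_of_nonneg (by positivity)]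
      have : M ^ 4 ≤ ρ * M ^ 4 := le_mul_of_one_le_left (by positivity) hρ
      nlinarith
    rw [e]
    refine (abs_add_le _ _).trans ?_
    rw [abs_mul, abs_mul]
    calc _ ≤ 32 * M ^ 4 * (64 * ρ * M ^ 3 * B) + 64 * M ^ 3 * B * (2 * ρ * M ^ 4) := by gcongr
      _ = 2176 * (ρ * M ^ 7 * B) := by ring
      _ ≤ 2200 * (ρ * M ^ 7 * B) := by gcongr; norm_num
      _ = _ := by ring
  unfold bump
  set D := (x ^ 4 + y ^ 4) * (x ^ 4 + ρ * y ^ 4)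
  set D' := (x' ^ 4 + y' ^ 4) * (x' ^ 4 + ρ * y' ^ 4)
  set N := |x * y| ^ (4 - s)
  set N' := |x' * y'| ^ (4 - s)
  have hD0 : 0 < D := lt_of_lt_of_le (by positivity) hD
  have hD'0 : 0 < D' := lt_of_lt_of_le (by positivity) hD'
  have hN'0 : 0 ≤ N' := by positivity
  clear_value D D' N N'
  have e : N' / D' - N / D = (N' - N) / D + N' * (D - D') / (D * D') := by
    field_simp; ring
  rw [e]
  refine (abs_add_le _ _).trans ?_
  rw [abs_div, abs_div, abs_mul, abs_of_pos hD0, abs_of_nonneg hN'0, abs_of_pos (mul_pos hD0 hD'0),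
    abs_sub_comm D D']
  calc _ ≤ 144 * M ^ 5 * B / M ^ 8 +
        64 * M ^ 6 * (2200 * ρ * M ^ 7 * B) / (M ^ 8 * (M ^ 8 / 256)) := by gcongr
    _ = (144 + 36044800 * ρ) * (B / M ^ 3) := by field_simp; ring
    _ ≤ (100000000 * ρ) * (B / M ^ 3) := by gcongr; linarith
    _ = _ := by ring

lemma exists_lower_bound_of_det_ne_zero {a₁ a₂ b₁ b₂ : ℝ} (hdet : a₁ * b₂ - a₂ * b₁ ≠ 0) :
    ∃ κ : ℝ, 0 < κ ∧ κ ≤ 1 ∧ ∀ v : Fin 2 → ℤ,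
      κ * ‖v‖ ≤ max |a₁ * v 0 + a₂ * v 1| |b₁ * v 0 + b₂ * v 1| := by
  set T := |a₁| + |a₂| + |b₁| + |b₂| + |a₁ * b₂ - a₂ * b₁| with hT
  have hd : 0 < |a₁ * b₂ - a₂ * b₁| := abs_pos.mpr hdet
  have hT0 : 0 < T := by positivity
  refine ⟨|a₁ * b₂ - a₂ * b₁| / T, by positivity, ?_, fun v => ?_⟩
  · rw [div_le_one hT0, hT]
    have : 0 ≤ |a₁| + |a₂| + |b₁| + |b₂| := by positivity
    linarith
  set x := a₁ * v 0 + a₂ * v 1 with hx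
  set y := b₁ * v 0 + b₂ * v 1 with hy
  set m := max |x| |y| with hm
  have hxm : |x| ≤ m := le_max_left _ _
  have hym : |y| ≤ m := le_max_right _ _
  have hm0 : 0 ≤ m := (abs_nonneg x).trans hxm
  rw [div_mul_eq_mul_div, div_le_iff₀ hT0]
  have key : ∀ p r : ℝ, |p| + |r| ≤ T → |p * x - r * y| ≤ m * T := fun p r h => by
    calc |p * x - r * y| ≤ |p * x| + |r * y| := abs_sub _ _
      _ = |p| * |x| + |r| * |y| := by rw [abs_mul, abs_mul]
      _ ≤ |p| * m + |r| * m := by gcongr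
      _ = m * (|p| + |r|) := by ring
      _ ≤ m * T := by gcongr
  have h0 := key b₂ a₂ (by rw [hT]; linarith [abs_nonneg a₁, abs_nonneg b₁])
  have h1 := key b₁ a₁ (by rw [hT]; linarith [abs_nonneg a₂, abs_nonneg b₂])
  rw [← le_div_iff₀' hd]
  refine (pi_norm_le_iff_of_nonneg (by positivity)).mpr fun i => ?_
  rw [le_div_iff₀' hd, Int.norm_eq_abs, ← abs_mul]
  fin_cases i
  · have e : (a₁ * b₂ - a₂ * b₁) * (v 0 : ℝ) = b₂ * x - a₂ * y := by rw [hx, hy]; ring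
    show |(a₁ * b₂ - a₂ * b₁) * (v 0 : ℝ)| ≤ m * T
    rwa [e]
  · have e : (a₁ * b₂ - a₂ * b₁) * (v 1 : ℝ) = -(b₁ * x - a₁ * y) := by rw [hx, hy]; ring
    show |(a₁ * b₂ - a₂ * b₁) * (v 1 : ℝ)| ≤ m * T
    rwa [e, abs_neg]

section LatticeSum

variable {ρ a₁ a₂ b₁ b₂ : ℝ}

lemma summable_bump_lattice (hρ : 1 ≤ ρ) (hdet : a₁ * b₂ - a₂ * b₁ ≠ 0) {s : ℝ} (hs1 : 1 < s)
    (hs2 : s ≤ 2) :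
    Summable fun v : Fin 2 → ℤ => bump ρ s (a₁ * v 0 + a₂ * v 1) (b₁ * v 0 + b₂ * v 1) := by
  obtain ⟨κ, hκ, -, h⟩ := exists_lower_bound_of_det_ne_zero hdet
  refine Summable.of_nonneg_of_le (fun v => bump_nonneg hρ _ _ _) (fun v => ?_)
    ((EisensteinSeries.summable_one_div_norm_rpow (k := 2 * s) (by linarith)).mul_left
      (κ ^ (-(2 * s))))
  rcases eq_or_ne v 0 with rfl | hv
  · simp only [bump, Pi.zero_apply]
    norm_num
    positivity
  · have hv' : 0 < ‖v‖ := norm_pos_iff.mpr hv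
    have hp : 0 < κ * ‖v‖ := by positivity
    refine (bump_le hρ hs2 (hp.trans_le (h v))).trans ?_
    rw [← Real.mul_rpow hκ.le hv'.le]
    exact Real.rpow_le_rpow_of_nonpos hp (h v) (by linarith)

lemma exists_bump_diff_bound (hρ : 1 ≤ ρ) (hdet : a₁ * b₂ - a₂ * b₁ ≠ 0) (u : Fin 2 → ℤ) :
    ∃ C : ℝ, 0 ≤ C ∧ ∀ s : ℝ, 1 < s → s ≤ 2 → ∀ v : Fin 2 → ℤ,
      |bump ρ s (a₁ * (v + u) 0 + a₂ * (v + u) 1) (b₁ * (v + u) 0 + b₂ * (v + u) 1) -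
        bump ρ s (a₁ * v 0 + a₂ * v 1) (b₁ * v 0 + b₂ * v 1)| ≤
      C * (‖v‖ ^ (-3 : ℝ) + if v = 0 then 1 else 0) := by
  obtain ⟨κ, hκ, hκ1, h⟩ := exists_lower_bound_of_det_ne_zero hdet
  set B := max |a₁ * u 0 + a₂ * u 1| |b₁ * u 0 + b₂ * u 1| with hB
  have hB0 : 0 ≤ B := (abs_nonneg _).trans (le_max_left _ _)
  set R := max 1 (2 * B) with hR
  have hR1 : 1 ≤ R := le_max_left _ _
  have hbd : ∀ s : ℝ, 1 < s → s ≤ 2 → ∀ v : Fin 2 → ℤ,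
      bump ρ s (a₁ * v 0 + a₂ * v 1) (b₁ * v 0 + b₂ * v 1) ≤ (κ ^ 4)⁻¹ := by
    intro s hs1 hs2 v
    rcases eq_or_ne v 0 with rfl | hv
    · simp only [bump, Pi.zero_apply]
      norm_num
      positivity
    · have hv1 : 1 ≤ ‖v‖ := by
        obtain ⟨i, hi⟩ := Function.ne_iff.mp hv
        refine le_trans ?_ (norm_le_pi_norm v i)
        rw [Int.norm_eq_abs]
        exact_mod_cast Int.one_le_abs hi
      have hκM : κ ≤ max |a₁ * v 0 + a₂ * v 1| |b₁ * v 0 + b₂ * v 1| :=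
        le_trans (by nlinarith) (h v)
      refine (bump_le hρ hs2 (hκ.trans_le hκM)).trans ?_
      refine (Real.rpow_le_rpow_of_nonpos hκ hκM (by linarith)).trans ?_
      refine (Real.rpow_le_rpow_of_exponent_ge hκ hκ1 (by linarith : (-4 : ℝ) ≤ _)).trans ?_
      rw [Real.rpow_neg hκ.le]
      norm_cast
  set C := 100000000 * ρ * B * (κ⁻¹) ^ 3 + (κ ^ 4)⁻¹ * (1 + (R / κ) ^ 3) with hC
  have hC0 : 0 ≤ C := by positivity
  refine ⟨C, hC0, fun s hs1 hs2 v => ?_⟩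
  set M := max |a₁ * v 0 + a₂ * v 1| |b₁ * v 0 + b₂ * v 1| with hM
  have hvr : ∀ w : Fin 2 → ℤ, ‖w‖ ^ (-3 : ℝ) = (‖w‖ ^ 3)⁻¹ := fun w => by
    rw [Real.rpow_neg (norm_nonneg _)]; norm_cast
  rw [hvr]
  by_cases hMR : R ≤ M
  · have hM1 : 1 ≤ M := hR1.trans hMR
    have hv : v ≠ 0 := by
      rintro rfl
      simp [hM] at hM1
      linarith
    have hv' : 0 < ‖v‖ := norm_pos_iff.mpr hv
    refine (abs_bump_sub_le (B := B) hρ hs1.le hs2 hM hM1 ((le_max_right _ _).trans hMR)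
      ?_ ?_).trans ?_
    · refine le_trans (le_of_eq ?_) (le_max_left _ _)
      congr 1; simp only [Pi.add_apply]; push_cast; ring
    · refine le_trans (le_of_eq ?_) (le_max_right _ _)
      congr 1; simp only [Pi.add_apply]; push_cast; ring
    · rw [if_neg hv, add_zero]
      calc 100000000 * ρ * B / M ^ 3 ≤ 100000000 * ρ * B / (κ * ‖v‖) ^ 3 := by
            gcongr; exact h v
        _ = 100000000 * ρ * B * (κ⁻¹) ^ 3 * (‖v‖ ^ 3)⁻¹ := by field_simp
        _ ≤ C * (‖v‖ ^ 3)⁻¹ := by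
            gcongr
            exact le_add_of_nonneg_right (by positivity)
  · push Not at hMR
    have hd : |bump ρ s (a₁ * (v + u) 0 + a₂ * (v + u) 1) (b₁ * (v + u) 0 + b₂ * (v + u) 1) -
        bump ρ s (a₁ * v 0 + a₂ * v 1) (b₁ * v 0 + b₂ * v 1)| ≤ (κ ^ 4)⁻¹ := by
      have h1 := hbd s hs1 hs2 v
      have h2 := hbd s hs1 hs2 (v + u)
      have h3 := bump_nonneg hρ s (a₁ * v 0 + a₂ * v 1) (b₁ * v 0 + b₂ * v 1)
      have h4 := bump_nonneg hρ s (a₁ * (v + u) 0 + a₂ * (v + u) 1)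
        (b₁ * (v + u) 0 + b₂ * (v + u) 1)
      rw [abs_le]; constructor <;> linarith
    refine hd.trans ?_
    have hge : (κ ^ 4)⁻¹ * (1 + (R / κ) ^ 3) ≤ C := le_add_of_nonneg_left (by positivity)
    by_cases hv : v = 0
    · rw [if_pos hv]
      have h1 : 0 ≤ (‖v‖ ^ 3)⁻¹ := by positivity
      have h2 : (κ ^ 4)⁻¹ ≤ (κ ^ 4)⁻¹ * (1 + (R / κ) ^ 3) :=
        le_mul_of_one_le_right (by positivity) (le_add_of_nonneg_right (by positivity))
      nlinarith
    · rw [if_neg hv, add_zero]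
      have hv' : 0 < ‖v‖ := norm_pos_iff.mpr hv
      have hvR : ‖v‖ ≤ R / κ := by
        rw [le_div_iff₀' hκ]; exact (h v).trans hMR.le
      calc (κ ^ 4)⁻¹ = (κ ^ 4)⁻¹ * ‖v‖ ^ 3 * (‖v‖ ^ 3)⁻¹ := by field_simp
        _ ≤ (κ ^ 4)⁻¹ * (1 + (R / κ) ^ 3) * (‖v‖ ^ 3)⁻¹ := by
            gcongr
            calc ‖v‖ ^ 3 ≤ (R / κ) ^ 3 := by gcongr
              _ ≤ _ := by linarith
        _ ≤ _ := by gcongr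

theorem exists_bound_periodic_bump_sum (hρ : 1 ≤ ρ) (hdet : a₁ * b₂ - a₂ * b₁ ≠ 0) {q : ℕ}
    [NeZero q] (c : ZMod q × ZMod q → ℂ) (hc : ∑ z, c z = 0) :
    ∃ C : ℝ, ∀ s : ℝ, 1 < s → s ≤ 2 →
      ‖∑' v : Fin 2 → ℤ, c (v 0, v 1) *
        (bump ρ s (a₁ * v 0 + a₂ * v 1) (b₁ * v 0 + b₂ * v 1) : ℂ)‖ ≤ C := by
  let l : ZMod q × ZMod q → Fin 2 → ℤ := fun u => ![(u.1.val : ℤ), (u.2.val : ℤ)]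
  choose D hD0 hD using fun u => exists_bump_diff_bound hρ hdet (l u)
  let τ : (Fin 2 → ℤ) → ℝ := fun v => ‖v‖ ^ (-3 : ℝ) + if v = 0 then 1 else 0
  have hτ : Summable τ := (EisensteinSeries.summable_one_div_norm_rpow (by norm_num)).add
    (summable_of_hasFiniteSupport ((Set.finite_singleton (0 : Fin 2 → ℤ)).subset
      fun v hv => by by_contra h; simp_all))
  let E : ℝ := ∑ z, ‖c z‖
  have hE : ∀ z, ‖c z‖ ≤ E := fun z =>
    Finset.single_le_sum (f := fun z => ‖c z‖) (fun _ _ => norm_nonneg _) (Finset.mem_univ z)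
  refine ⟨∑' v, (E * ∑ u, D u) * τ v, fun s hs1 hs2 => ?_⟩
  let G : (Fin 2 → ℤ) → ℝ := fun v => bump ρ s (a₁ * v 0 + a₂ * v 1) (b₁ * v 0 + b₂ * v 1)
  let F : (Fin 2 → ℤ) → ℂ := fun v => c (v 0, v 1) * (G v : ℂ)
  have hG : Summable G := summable_bump_lattice hρ hdet hs1 hs2
  have hF : Summable F := by
    refine Summable.of_norm_bounded (hG.mul_left E) fun v => ?_
    rw [norm_mul, Complex.norm_real, Real.norm_of_nonneg (bump_nonneg hρ _ _ _)]
    exact mul_le_mul_of_nonneg_right (hE _) (bump_nonneg hρ _ _ _)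
  have hshift : ∀ u, ∑' v, F (v + l u) = ∑' v, F v := fun u => (Equiv.addRight (l u)).tsum_eq F
  have hFs : ∀ u, Summable fun v => F (v + l u) := fun u =>
    (Equiv.addRight (l u)).summable_iff.mpr hF
  have hcl : ∀ (u : ZMod q × ZMod q) (v : Fin 2 → ℤ),
      (((v + l u) 0 : ℤ) : ZMod q) = (v 0 : ZMod q) + u.1 ∧
      (((v + l u) 1 : ℤ) : ZMod q) = (v 1 : ZMod q) + u.2 := fun u v => by
    simp [l]
  have hzero : ∀ v : Fin 2 → ℤ, ∑ u, c ((v + l u) 0, (v + l u) 1) = 0 := fun v => by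
    rw [← hc, ← Equiv.sum_comp (Equiv.addLeft ((v 0 : ZMod q), (v 1 : ZMod q))) c]
    refine Finset.sum_congr rfl fun u _ => ?_
    rw [(hcl u v).1, (hcl u v).2]
    rfl
  have hsum : (Fintype.card (ZMod q × ZMod q) : ℂ) * ∑' v, F v =
      ∑' v, ∑ u, c ((v + l u) 0, (v + l u) 1) * ((G (v + l u) : ℂ) - (G v : ℂ)) := by
    calc _ = ∑ u, ∑' v, F (v + l u) := by simp [hshift]
      _ = ∑' v, ∑ u, F (v + l u) := (Summable.tsum_finsetSum fun u _ => hFs u).symm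
      _ = _ := by
        refine tsum_congr fun v => ?_
        simp only [mul_sub, Finset.sum_sub_distrib, ← Finset.sum_mul, hzero, zero_mul, sub_zero, F]
  have hterm : ∀ v, ‖∑ u, c ((v + l u) 0, (v + l u) 1) * ((G (v + l u) : ℂ) - (G v : ℂ))‖ ≤
      (E * ∑ u, D u) * τ v := fun v => by
    refine (norm_sum_le _ _).trans ?_
    rw [Finset.mul_sum, Finset.sum_mul]
    refine Finset.sum_le_sum fun u _ => ?_
    rw [norm_mul, ← Complex.ofReal_sub, Complex.norm_real, Real.norm_eq_abs, mul_assoc]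
    exact mul_le_mul (hE _) (hD u s hs1 hs2 v) (abs_nonneg _) ((norm_nonneg _).trans (hE 0))
  have hcard : (1 : ℝ) ≤ Fintype.card (ZMod q × ZMod q) := by
    exact_mod_cast Fintype.card_pos
  calc ‖∑' v, F v‖ ≤ Fintype.card (ZMod q × ZMod q) * ‖∑' v, F v‖ :=
        le_mul_of_one_le_left (norm_nonneg _) hcard
    _ = ‖(Fintype.card (ZMod q × ZMod q) : ℂ) * ∑' v, F v‖ := by
        rw [norm_mul, Complex.norm_natCast]
    _ ≤ _ := by
        rw [hsum]
        exact tsum_of_norm_bounded (hτ.mul_left _).hasSum hterm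

end LatticeSum

open Filter Topology in
lemma hasSum_int_sub_of_monotone {G : ℤ → ℝ} (hG : Monotone G) {a b : ℝ}
    (ha : Tendsto (fun n : ℕ => G n) atTop (𝓝 a))
    (hb : Tendsto (fun n : ℕ => G (-n)) atTop (𝓝 b)) :
    HasSum (fun k : ℤ => G k - G (k - 1)) (a - b) := by
  have h1 : HasSum (fun n : ℕ => G n - G ((n : ℤ) - 1)) (a - G (-1)) := by
    rw [hasSum_iff_tendsto_nat_of_nonneg
      (fun n => sub_nonneg.mpr (hG (by lia)))]
    have : ∀ N : ℕ, ∑ i ∈ Finset.range N, (G i - G ((i : ℤ) - 1)) = G ((N : ℤ) - 1) - G (-1) := by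
      intro N
      induction N with
      | zero => simp
      | succ N ih => rw [Finset.sum_range_succ, ih]; push_cast; ring_nf
    simp_rw [this]
    refine Tendsto.sub_const ?_ _
    rw [← tendsto_add_atTop_iff_nat 1]
    simpa using ha
  have h2 : HasSum (fun n : ℕ => G (-((n : ℤ) + 1)) - G (-((n : ℤ) + 1) - 1)) (G (-1) - b) := by
    rw [hasSum_iff_tendsto_nat_of_nonneg
      (fun n => sub_nonneg.mpr (hG (by lia)))]
    have : ∀ N : ℕ, ∑ i ∈ Finset.range N, (G (-((i : ℤ) + 1)) - G (-((i : ℤ) + 1) - 1)) =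
        G (-1) - G (-((N + 1 : ℕ) : ℤ)) := by
      intro N
      induction N with
      | zero => simp
      | succ N ih =>
        rw [Finset.sum_range_succ, ih]
        have : (-((N : ℤ) + 1) - 1) = -((N + 1 + 1 : ℕ) : ℤ) := by push_cast; ring
        rw [this]; push_cast; ring
    simp_rw [this]
    exact (((tendsto_add_atTop_iff_nat 1).mpr hb).const_sub _)
  have := HasSum.of_nat_of_neg_add_one (f := fun k : ℤ => G k - G (k - 1)) h1 h2
  simpa using this

open Filter Topology in
lemma hasSum_bump_orbit {E : ℝ} (hE : 1 < E) {x y e₁ e₂ : ℝ} (hx : x ≠ 0) (hy : y ≠ 0)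
    (h₁ : e₁ ^ 4 = E) (h₂ : e₂ ^ 4 = E⁻¹) :
    HasSum (fun k : ℤ => bump (E ^ 2) 0 (e₁ ^ k * x) (e₂ ^ k * y)) (E ^ 2 - 1)⁻¹ := by
  have hE0 : 0 < E := by linarith
  have hρ : 1 < E ^ 2 := one_lt_pow₀ hE two_ne_zero
  set X := x ^ 4 with hX
  set Y := y ^ 4 with hY
  have hX0 : 0 < X := by positivity
  have hY0 : 0 < Y := by positivity
  set G : ℤ → ℝ := fun k => X / (X + (E ^ 2) ^ (-k) * Y) with hGdef
  have hG : Monotone G := by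
    intro i j hij
    simp only [hGdef]
    have : (E ^ 2) ^ (-j) ≤ (E ^ 2) ^ (-i) := zpow_le_zpow_right₀ hρ.le (by lia)
    gcongr
  have ha : Tendsto (fun n : ℕ => G n) atTop (𝓝 1) := by
    have h0 : Tendsto (fun n : ℕ => ((E ^ 2)⁻¹) ^ n) atTop (𝓝 0) :=
      tendsto_pow_atTop_nhds_zero_of_lt_one (by positivity) (inv_lt_one_of_one_lt₀ hρ)
    have := (tendsto_const_nhds (x := X)).div ((h0.mul_const Y).const_add X) (by simpa using hX0.ne')
    simp only [zero_mul, add_zero, div_self hX0.ne'] at this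
    refine this.congr fun n => ?_
    simp [hGdef, zpow_neg]
  have hb : Tendsto (fun n : ℕ => G (-n)) atTop (𝓝 0) := by
    have h0 : Tendsto (fun n : ℕ => (E ^ 2) ^ n) atTop atTop := tendsto_pow_atTop_atTop_of_one_lt hρ
    have := (tendsto_atTop_add_const_left _ X (h0.atTop_mul_const hY0)).const_div_atTop X
    refine this.congr fun n => ?_
    simp [hGdef]
  have := (hasSum_int_sub_of_monotone hG ha hb).mul_left (E ^ 2 - 1)⁻¹
  rw [sub_zero, mul_one] at this
  refine this.congr_fun fun k => ?_
  have ha0 : 0 < E ^ k := zpow_pos hE0 k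
  have p₁ : (e₁ ^ k) ^ 4 = E ^ k := by rw [← h₁, ← zpow_natCast, zpow_comm, zpow_natCast]
  have p₂ : (e₂ ^ k) ^ 4 = (E ^ k)⁻¹ := by
    rw [← inv_zpow, ← h₂, ← zpow_natCast, zpow_comm, zpow_natCast]
  have p₃ : (E ^ 2) ^ (-k) = (E ^ k)⁻¹ ^ 2 := by
    rw [zpow_neg, inv_pow, ← zpow_natCast, ← zpow_natCast, zpow_comm]
  have p₄ : (E ^ 2) ^ (-(k - 1)) = (E ^ k)⁻¹ ^ 2 * E ^ 2 := by
    rw [neg_sub, sub_eq_neg_add, zpow_add₀ (by positivity), p₃, zpow_one]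
  have hb0 : |e₁ ^ k * x * (e₂ ^ k * y)| ^ ((4 : ℝ) - 0) = X * Y := by
    rw [sub_zero, show (4 : ℝ) = ((4 : ℕ) : ℝ) by norm_num, Real.rpow_natCast,
      Even.pow_abs (by decide), mul_pow, mul_pow, mul_pow, p₁, p₂, hX, hY]
    field_simp
  have hρ' : E ^ 2 - 1 ≠ 0 := by linarith
  simp only [hGdef]
  rw [bump, hb0, mul_pow, mul_pow, p₁, p₂, p₃, p₄, ← hX, ← hY]
  have n1 : E ^ k * X + (E ^ k)⁻¹ * Y ≠ 0 := by positivity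
  have n2 : E ^ k * X + E ^ 2 * ((E ^ k)⁻¹ * Y) ≠ 0 := by positivity
  have n3 : X + (E ^ k)⁻¹ ^ 2 * Y ≠ 0 := by positivity
  have n4 : X + (E ^ k)⁻¹ ^ 2 * E ^ 2 * Y ≠ 0 := by positivity
  have m1 : E ^ k * X + (E ^ k)⁻¹ * Y = E ^ k * (X + (E ^ k)⁻¹ ^ 2 * Y) := by field_simp
  have m2 : E ^ k * X + E ^ 2 * ((E ^ k)⁻¹ * Y) = E ^ k * (X + (E ^ k)⁻¹ ^ 2 * E ^ 2 * Y) := by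
    field_simp
  rw [m1, m2]
  rw [div_sub_div _ _ n3 n4, inv_mul_eq_div, div_div, div_eq_div_iff (by positivity) (by positivity)]
  field_simp
  ring

section RealQuadraticField

variable (K : Type*) [Field K] [NumberField K]

lemma exists_real_embeddings [IsTotallyReal K] (hK : finrank ℚ K = 2) :
    ∃ σ₁ σ₂ : K →+* ℝ, (∀ x, (Algebra.norm ℚ x : ℝ) = σ₁ x * σ₂ x) ∧
      (∀ x, ∀ w : InfinitePlace K, w x = |σ₁ x| ∨ w x = |σ₂ x|) ∧
      (∀ x, ∃ w : InfinitePlace K, w x = |σ₁ x|) ∧ (∀ x, ∃ w : InfinitePlace K, w x = |σ₂ x|) := by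
  classical
  have hcard : Fintype.card (K →+* ℂ) = 2 := by rw [Embeddings.card, hK]
  obtain ⟨φ₁, φ₂, hne, huniv⟩ := Finset.card_eq_two.mp (Finset.card_univ.trans hcard)
  have hr : ∀ φ : K →+* ℂ, ComplexEmbedding.IsReal φ := fun φ =>
    IsTotallyReal.complexEmbedding_isReal φ
  have hval : ∀ (φ : K →+* ℂ) (x : K), ‖φ x‖ = |(hr φ).embedding x| := fun φ x => by
    rw [← (hr φ).coe_embedding_apply x, Complex.norm_real, Real.norm_eq_abs]
  refine ⟨(hr φ₁).embedding, (hr φ₂).embedding, fun x => ?_, fun x w => ?_, fun x => ?_, fun x => ?_⟩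
  · have h := Algebra.norm_eq_prod_embeddings ℚ ℂ x
    rw [← (RingHom.equivRatAlgHom (R := K) (S := ℂ)).prod_comp] at h
    rw [huniv, Finset.prod_pair hne] at h
    have h2 : ((Algebra.norm ℚ x : ℝ) : ℂ) =
        (((hr φ₁).embedding x * (hr φ₂).embedding x : ℝ) : ℂ) := by
      push_cast
      rw [(hr φ₁).coe_embedding_apply x, (hr φ₂).coe_embedding_apply x]
      simpa using h
    exact_mod_cast h2
  · have : w.embedding ∈ (Finset.univ : Finset (K →+* ℂ)) := Finset.mem_univ _
    rw [huniv, Finset.mem_insert, Finset.mem_singleton] at this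
    rw [← InfinitePlace.norm_embedding_eq]
    rcases this with h | h
    · left; rw [h, hval]
    · right; rw [h, hval]
  · exact ⟨InfinitePlace.mk φ₁, by rw [InfinitePlace.apply, hval]⟩
  · exact ⟨InfinitePlace.mk φ₂, by rw [InfinitePlace.apply, hval]⟩

lemma units_rank_eq_one [IsTotallyReal K] (hK : finrank ℚ K = 2) : Units.rank K = 1 := by
  have h := IsTotallyReal.finrank (K := K)
  have h2 := InfinitePlace.card_add_two_mul_card_eq_rank K
  have h3 := InfinitePlace.card_eq_nrRealPlaces_add_nrComplexPlaces K
  have h4 := IsTotallyReal.nrComplexPlaces_eq_zero K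
  rw [Units.rank]
  lia

/-- In a real quadratic field, a bump function summed along the orbit of the unit group is a
nonzero constant. -/
theorem exists_hasSum_bump_units [IsTotallyReal K] (hK : finrank ℚ K = 2) :
    ∃ (σ₁ σ₂ : K →+* ℝ) (ρ κ : ℝ), 1 < ρ ∧ 0 < κ ∧
      (∀ x, (Algebra.norm ℚ x : ℝ) = σ₁ x * σ₂ x) ∧
      ∀ α : K, α ≠ 0 → HasSum (fun u : (𝓞 K)ˣ =>
        bump ρ 0 (σ₁ (algebraMap (𝓞 K) K u * α)) (σ₂ (algebraMap (𝓞 K) K u * α))) κ := by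
  obtain ⟨σ₁', σ₂', hnorm', hw', hw₁', hw₂'⟩ := exists_real_embeddings K hK
  have hrk := units_rank_eq_one K hK
  let i₀ : Fin (Units.rank K) := ⟨0, by lia⟩
  have : Unique (Fin (Units.rank K)) := ⟨⟨i₀⟩, fun j => Fin.ext (by simp [i₀]; lia)⟩
  set ε := Units.fundSystem K default with hε
  have hb : ∀ x : (𝓞 K)ˣ, ∃! ζe : Units.torsion K × ℤ, x = ζe.1 * ε ^ ζe.2 := by
    intro x
    obtain ⟨⟨z, e⟩, he, huq⟩ := Units.exist_unique_eq_mul_prod K x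
    refine ⟨⟨z, e default⟩, by simpa using he, fun ⟨z', e'⟩ h => ?_⟩
    have := huq ⟨z', fun _ => e'⟩ (by simpa using h)
    simp only [Prod.mk.injEq] at this ⊢
    exact ⟨this.1, by rw [← this.2]⟩
  have hε1 : ∀ u : (𝓞 K)ˣ, |σ₁' u| * |σ₂' u| = 1 := fun u => by
    rw [← abs_mul, ← hnorm']
    have := Units.norm K u
    exact_mod_cast this
  have hεt : ε ∉ Units.torsion K := by
    intro hmem
    have := (hb ε).unique (y₁ := (⟨ε, hmem⟩, 0)) (y₂ := (1, 1)) (by simp) (by simp)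
    simp at this
  have hε2 : |σ₁' ε| ≠ 1 := by
    intro h
    apply hεt
    rw [Units.mem_torsion]
    intro w
    rcases hw' ε w with h' | h'
    · rw [h', h]
    · rw [h']; have := hε1 ε; rwa [h, one_mul] at this
  obtain ⟨σ₁, σ₂, hnorm, hw₁, hw₂, hgt, hun⟩ : ∃ σ₁ σ₂ : K →+* ℝ,
      (∀ x, (Algebra.norm ℚ x : ℝ) = σ₁ x * σ₂ x) ∧ (∀ x, ∃ w : InfinitePlace K, w x = |σ₁ x|) ∧
      (∀ x, ∃ w : InfinitePlace K, w x = |σ₂ x|) ∧ 1 < |σ₁ ε| ∧ |σ₁ ε| * |σ₂ ε| = 1 := by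
    rcases lt_or_gt_of_ne hε2 with h | h
    · refine ⟨σ₂', σ₁', fun x => by rw [hnorm', mul_comm], hw₂', hw₁', ?_, by
        rw [mul_comm]; exact hε1 ε⟩
      have h1 := hε1 ε
      by_contra! h2
      nlinarith [abs_nonneg (σ₁' ε), abs_nonneg (σ₂' ε)]
    · exact ⟨σ₁', σ₂', hnorm', hw₁', hw₂', h, hε1 ε⟩
  have htor : ∀ z : Units.torsion K, |σ₁ (algebraMap (𝓞 K) K (z : (𝓞 K)ˣ))| = 1 ∧
      |σ₂ (algebraMap (𝓞 K) K (z : (𝓞 K)ˣ))| = 1 := fun z => by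
    have hz := (Units.mem_torsion K).mp z.2
    obtain ⟨w, hw⟩ := hw₁ (algebraMap (𝓞 K) K (z : (𝓞 K)ˣ))
    obtain ⟨w', hw'⟩ := hw₂ (algebraMap (𝓞 K) K (z : (𝓞 K)ˣ))
    exact ⟨by rw [← hw, hz], by rw [← hw', hz]⟩
  set E := (σ₁ ε) ^ 4 with hE
  have hE1 : 1 < E := by
    rw [hE, ← Even.pow_abs (by decide)]; exact one_lt_pow₀ hgt (by norm_num)
  have hE2 : (σ₂ ε) ^ 4 = E⁻¹ := by
    rw [← mul_eq_one_iff_eq_inv₀ (by positivity), hE, ← Even.pow_abs (by decide) (σ₂ _),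
      ← Even.pow_abs (by decide) (σ₁ _), ← mul_pow, mul_comm, hun, one_pow]
  have hρ : 1 < E ^ 2 := one_lt_pow₀ hE1 two_ne_zero
  refine ⟨σ₁, σ₂, E ^ 2, Nat.card (Units.torsion K) * (E ^ 2 - 1)⁻¹, hρ, ?_, hnorm,
    fun α hα => ?_⟩
  · have : 0 < Nat.card (Units.torsion K) := Nat.card_pos
    have : 0 < E ^ 2 - 1 := by linarith
    positivity
  let eqv : Units.torsion K × ℤ ≃ (𝓞 K)ˣ := Equiv.ofBijective (fun p => p.1 * ε ^ p.2)
    ⟨fun p p' h => (hb _).unique rfl h, fun x => by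
      obtain ⟨p, hp, -⟩ := hb x; exact ⟨p, hp.symm⟩⟩
  rw [← eqv.hasSum_iff]
  have key := hasSum_bump_orbit hE1 ((map_ne_zero σ₁).mpr hα) ((map_ne_zero σ₂).mpr hα) hE.symm hE2
  have hone : HasSum (fun _ : Units.torsion K => (1 : ℝ)) (Nat.card (Units.torsion K)) := by
    have := Fintype.ofFinite (Units.torsion K)
    convert hasSum_fintype (fun _ : Units.torsion K => (1 : ℝ)) using 1
    simp
  refine (hone.mul key (hone.summable.mul_of_nonneg key.summable (fun _ => zero_le_one)
    fun _ => bump_nonneg hρ.le _ _ _)).congr_fun fun p => ?_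
  have habs : ∀ a b c d : ℝ, |a| = |c| → |b| = |d| → bump (E ^ 2) 0 a b = bump (E ^ 2) 0 c d := by
    intro a b c d h h'
    rw [bump, bump, abs_mul, abs_mul, h, h', ← Even.pow_abs (by decide) a,
      ← Even.pow_abs (by decide) b, h, h', Even.pow_abs (by decide), Even.pow_abs (by decide)]
  simp only [Function.comp, one_mul]
  have hval : algebraMap (𝓞 K) K (eqv p : (𝓞 K)ˣ) =
      algebraMap (𝓞 K) K (p.1 : (𝓞 K)ˣ) * algebraMap (𝓞 K) K ε ^ p.2 := by
    show algebraMap (𝓞 K) K (p.1 * ε ^ p.2 : (𝓞 K)ˣ) = _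
    rw [Units.coe_mul, Units.coe_zpow]
  rw [hval]
  apply habs
  · rw [map_mul, map_mul, abs_mul, abs_mul, (htor p.1).1, one_mul, map_zpow₀, abs_mul]
  · rw [map_mul, map_mul, abs_mul, abs_mul, (htor p.1).2, one_mul, map_zpow₀, abs_mul]

end RealQuadraticField

section QuadraticIdeals

variable {K : Type*} [Field K] [NumberField K]

lemma quadratic_det_ne_zero {σ₁ σ₂ : K →+* ℝ}
    (hnorm : ∀ x, (Algebra.norm ℚ x : ℝ) = σ₁ x * σ₂ x) {x y : K}
    (hli : ∀ a b : ℤ, a * x + b * y = 0 → a = 0 ∧ b = 0) :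
    σ₁ x * σ₂ y - σ₁ y * σ₂ x ≠ 0 := by
  intro h
  have hy : y ≠ 0 := by
    rintro rfl
    simpa using hli 0 1
  have h1 : σ₁ y ≠ 0 := (map_ne_zero σ₁).mpr hy
  have h2 : σ₂ y ≠ 0 := (map_ne_zero σ₂).mpr hy
  have ht : σ₂ (x / y) = σ₁ (x / y) := by
    rw [map_div₀, map_div₀, div_eq_div_iff h2 h1]; linarith
  set t := x / y with htdef
  have hN : (Algebra.norm ℚ t : ℝ) = σ₁ t ^ 2 := by rw [hnorm, ht, sq]
  have hN1 : (Algebra.norm ℚ (t + 1) : ℝ) = (σ₁ t + 1) ^ 2 := by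
    rw [hnorm, map_add, map_add, ht, map_one, map_one, sq]
  set r : ℚ := (Algebra.norm ℚ (t + 1) - Algebra.norm ℚ t - 1) / 2 with hr
  have hrt : σ₁ (r : K) = σ₁ t := by
    rw [map_ratCast, hr]; push_cast; rw [hN, hN1]; ring
  have hrt' : (r : K) = t := σ₁.injective hrt
  have hxy : (r : K) * y = x := by rw [hrt', htdef, div_mul_cancel₀ _ hy]
  have hd : ((r.den : ℤ) : K) * x + ((-r.num : ℤ) : K) * y = 0 := by
    rw [← hxy, ← mul_assoc]
    have : ((r.den : ℤ) : K) * (r : K) = (r.num : K) := by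
      have := Rat.den_mul_eq_num r
      exact_mod_cast congrArg (Rat.cast : ℚ → K) this
    rw [this]; push_cast; ring
  have := (hli _ _ hd).1
  exact r.den_ne_zero (by exact_mod_cast this)

lemma exists_norm_form {σ₁ σ₂ : K →+* ℝ}
    (hnorm : ∀ x, (Algebra.norm ℚ x : ℝ) = σ₁ x * σ₂ x) (J : Ideal (𝓞 K)) {x y : 𝓞 K}
    (hx : x ∈ J) (hy : y ∈ J) :
    ∃ A B C : ℤ, ∀ a b : ℤ, Algebra.norm ℤ (a * x + b * y : 𝓞 K) =
      Ideal.absNorm J * (A * a ^ 2 + B * a * b + C * b ^ 2) := by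
  obtain ⟨A, hA⟩ := Ideal.absNorm_dvd_norm_of_mem hx
  obtain ⟨C, hC⟩ := Ideal.absNorm_dvd_norm_of_mem hy
  obtain ⟨D, hD⟩ := Ideal.absNorm_dvd_norm_of_mem (J.add_mem hx hy)
  have hi : ∀ z : 𝓞 K, ((Algebra.norm ℤ z : ℤ) : ℝ) =
      σ₁ (algebraMap (𝓞 K) K z) * σ₂ (algebraMap (𝓞 K) K z) := fun z => by
    rw [← hnorm, ← Algebra.coe_norm_int]; simp
  refine ⟨A, D - A - C, C, fun a b => ?_⟩
  have hA' : ((Algebra.norm ℤ x : ℤ) : ℝ) = _ := congrArg (Int.cast : ℤ → ℝ) hA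
  have hC' : ((Algebra.norm ℤ y : ℤ) : ℝ) = _ := congrArg (Int.cast : ℤ → ℝ) hC
  have hD' : ((Algebra.norm ℤ (x + y) : ℤ) : ℝ) = _ := congrArg (Int.cast : ℤ → ℝ) hD
  rw [hi] at hA' hC' hD'
  have : ((Algebra.norm ℤ (a * x + b * y : 𝓞 K) : ℤ) : ℝ) =
      ((Ideal.absNorm J * (A * a ^ 2 + (D - A - C) * a * b + C * b ^ 2) : ℤ) : ℝ) := by
    rw [hi]
    simp only [map_add, map_mul, map_intCast] at hA' hC' hD' ⊢
    push_cast at hA' hC' hD' ⊢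
    linear_combination (a ^ 2 - a * b : ℝ) * hA' + (b ^ 2 - a * b : ℝ) * hC' + (a * b : ℝ) * hD'
  exact_mod_cast this

/-- The Dirichlet series term attached to an ideal in the class opposite to `J`. -/
def classTerm (J : Ideal (𝓞 K)) {q : ℕ} (ψ : MulChar (ZMod q) ℂ) (s : ℝ) (I : Ideal (𝓞 K)) : ℂ :=
  open Classical in
  if I ≠ ⊥ ∧ ∃ α, I * J = Ideal.span {α} then
    ψ (Ideal.absNorm I : ZMod q) * (((Ideal.absNorm I : ℝ) ^ (-s) : ℝ) : ℂ) else 0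

lemma bump_eq_rpow_mul {ρ s x y : ℝ} (hx : x ≠ 0) (hy : y ≠ 0) :
    bump ρ s x y = |x * y| ^ (-s) * bump ρ 0 x y := by
  rw [bump, bump, ← mul_div_assoc, ← Real.rpow_add (by positivity)]
  congr 2; ring

lemma bump_zero_zero {ρ s : ℝ} : bump ρ s 0 0 = 0 := by simp [bump]

lemma exists_mul_eq_span (J : Ideal (𝓞 K)) (α : J) :
    ∃ I : Ideal (𝓞 K), I * J = Ideal.span {(α : 𝓞 K)} := by
  obtain ⟨I, hI⟩ := Ideal.dvd_span_singleton.mpr α.2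
  exact ⟨I, by rw [hI, mul_comm]⟩

/-- The cofactor of an ideal `J` in the principal ideal generated by one of its elements. -/
def cofactor (J : Ideal (𝓞 K)) (α : J) : Ideal (𝓞 K) := (exists_mul_eq_span J α).choose

lemma cofactor_mul (J : Ideal (𝓞 K)) (α : J) : cofactor J α * J = Ideal.span {(α : 𝓞 K)} :=
  (exists_mul_eq_span J α).choose_spec

lemma cofactor_eq_iff {J : Ideal (𝓞 K)} (hJ : J ≠ ⊥) {α : J} {I : Ideal (𝓞 K)} :
    cofactor J α = I ↔ I * J = Ideal.span {(α : 𝓞 K)} := by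
  rw [← cofactor_mul J α]
  exact ⟨fun h => by rw [h], fun h => mul_right_cancel₀ hJ h.symm⟩

/-- The fibre of the cofactor map is a torsor under the unit group. -/
def unitsEquivFiber {J : Ideal (𝓞 K)} (hJ : J ≠ ⊥) {α : J} (hα : (α : 𝓞 K) ≠ 0) {I : Ideal (𝓞 K)}
    (h : I * J = Ideal.span {(α : 𝓞 K)}) : (𝓞 K)ˣ ≃ (cofactor J ⁻¹' {I}) :=
  Equiv.ofBijective (fun u => ⟨⟨u * α, J.mul_mem_left _ α.2⟩, by
      rw [Set.mem_preimage, Set.mem_singleton_iff, cofactor_eq_iff hJ, h]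
      rw [Ideal.span_singleton_eq_span_singleton]
      exact (associated_unit_mul_left _ _ u.isUnit).symm⟩)
    ⟨fun u v huv => by
      simp only [Subtype.mk.injEq] at huv
      exact Units.ext (mul_right_cancel₀ hα huv),
    fun ⟨β, hβ⟩ => by
      rw [Set.mem_preimage, Set.mem_singleton_iff, cofactor_eq_iff hJ, h,
        Ideal.span_singleton_eq_span_singleton] at hβ
      obtain ⟨u, hu⟩ := hβ
      exact ⟨u, by ext; simp [← hu, mul_comm]⟩⟩

theorem exists_bound_tsum_classTerm [IsTotallyReal K] (hK : finrank ℚ K = 2) {q : ℕ} [NeZero q]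
    (ψ : MulChar (ZMod q) ℂ) (hψ1 : ψ (-1) = 1) {a : (ZMod q)ˣ} (ha : ψ a ^ 2 ≠ 1)
    {J : Ideal (𝓞 K)} (hJ : J ≠ ⊥) :
    ∃ C : ℝ, ∀ s : ℝ, 1 < s → s ≤ 2 → ‖∑' I, classTerm J ψ s I‖ ≤ C := by
  obtain ⟨σ₁, σ₂, ρ, κ, hρ, hκ, hnorm, hsum⟩ := exists_hasSum_bump_units K hK
  have hi : ∀ z : 𝓞 K, ((Algebra.norm ℤ z : ℤ) : ℝ) =
      σ₁ (algebraMap (𝓞 K) K z) * σ₂ (algebraMap (𝓞 K) K z) := fun z => by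
    rw [← hnorm, ← Algebra.coe_norm_int]; simp
  have hcard : Fintype.card (Free.ChooseBasisIndex ℤ (𝓞 K)) = Fintype.card (Fin 2) := by
    rw [← finrank_eq_card_chooseBasisIndex, RingOfIntegers.rank, hK, Fintype.card_fin]
  let e : Basis (Fin 2) ℤ J :=
    Ideal.selfBasis ((RingOfIntegers.basis K).reindex (Fintype.equivOfCardEq hcard)) J hJ
  set M := Ideal.absNorm J with hM
  have hM0 : 0 < M := Nat.pos_of_ne_zero (by rwa [hM, Ne, Ideal.absNorm_eq_zero_iff])
  obtain ⟨A, B, C, hABC⟩ := exists_norm_form hnorm J (e 0).2 (e 1).2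
  have hev : ∀ v : Fin 2 → ℤ, ((e.equivFun.symm v : J) : 𝓞 K) =
      v 0 * (e 0 : 𝓞 K) + v 1 * (e 1 : 𝓞 K) := fun v => by
    rw [e.equivFun_symm_apply, Fin.sum_univ_two]; simp
  have hdet := quadratic_det_ne_zero hnorm (x := algebraMap (𝓞 K) K (e 0))
    (y := algebraMap (𝓞 K) K (e 1)) (fun a b h => by
      have h0 : e.equivFun.symm ![a, b] = 0 := by
        apply Subtype.ext
        apply RingOfIntegers.coe_injective
        rw [hev]
        simpa using h
      rw [LinearEquiv.map_eq_zero_iff] at h0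
      exact ⟨by simpa using congrFun h0 0, by simpa using congrFun h0 1⟩)
  let c : ZMod q × ZMod q → ℂ := fun z => ψ (A * z.1 ^ 2 + B * z.1 * z.2 + C * z.2 ^ 2)
  have hc : ∑ z, c z = 0 := by
    have h1 : ∑ z, c z = ψ a ^ 2 * ∑ z, c z := by
      rw [Finset.mul_sum]
      rw [← (Equiv.prodCongr (Units.mulLeft a) (Units.mulLeft a)).sum_comp]
      refine Finset.sum_congr rfl fun z _ => ?_
      simp only [c, Equiv.prodCongr_apply, Prod.map, Units.mulLeft_apply]
      rw [← map_pow, ← map_mul]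
      congr 1; ring
    have h2 : (1 - ψ a ^ 2) * ∑ z, c z = 0 := by rw [sub_mul, one_mul, ← h1, sub_self]
    exact (mul_eq_zero.mp h2).resolve_left (sub_ne_zero.mpr ha.symm)
  obtain ⟨D, hD⟩ := exists_bound_periodic_bump_sum hρ.le hdet c hc
  refine ⟨D * M ^ 2 / κ, fun s hs1 hs2 => ?_⟩
  let f : J → ℂ := fun α => ψ (Ideal.absNorm (cofactor J α) : ZMod q) *
    (bump ρ s (σ₁ (algebraMap (𝓞 K) K α)) (σ₂ (algebraMap (𝓞 K) K α)) : ℝ)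
  have habs : ∀ α : J, (M : ℤ) * Ideal.absNorm (cofactor J α) =
      |Algebra.norm ℤ (α : 𝓞 K)| := fun α => by
    have := congrArg Ideal.absNorm (cofactor_mul J α)
    rw [map_mul, Ideal.absNorm_span_singleton] at this
    rw [← Int.natCast_natAbs, ← this, hM]
    push_cast; ring
  have hψn : ∀ n : ℤ, ψ ((|n| : ℤ) : ZMod q) = ψ (n : ZMod q) := fun n => by
    rcases abs_choice n with h | h
    · rw [h]
    · rw [h, Int.cast_neg, neg_eq_neg_one_mul, map_mul, hψ1, one_mul]
  have hf : ∀ v : Fin 2 → ℤ, f (e.equivFun.symm v) = c (v 0, v 1) *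
      (bump ρ s (σ₁ (algebraMap (𝓞 K) K (e 0)) * v 0 + σ₁ (algebraMap (𝓞 K) K (e 1)) * v 1)
        (σ₂ (algebraMap (𝓞 K) K (e 0)) * v 0 + σ₂ (algebraMap (𝓞 K) K (e 1)) * v 1) : ℝ) := by
    intro v
    have hσ : ∀ σ : K →+* ℝ, σ (algebraMap (𝓞 K) K (e.equivFun.symm v : J)) =
        σ (algebraMap (𝓞 K) K (e 0)) * v 0 + σ (algebraMap (𝓞 K) K (e 1)) * v 1 := fun σ => by
      rw [hev]; simp [mul_comm]
    simp only [f, hσ, c]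
    congr 1
    have h1 := habs (e.equivFun.symm v)
    rw [hev, hABC, abs_mul, Nat.abs_cast] at h1
    have h2 := mul_left_cancel₀ (by exact_mod_cast hM0.ne') h1
    have h3 := congrArg (Int.cast : ℤ → ZMod q) h2
    rw [Int.cast_natCast] at h3
    rw [h3, hψn]
    push_cast; rfl
  have hsumm : Summable f := by
    rw [← e.equivFun.symm.toEquiv.summable_iff]
    refine Summable.of_norm_bounded (summable_bump_lattice hρ.le hdet hs1 hs2) fun v => ?_
    show ‖f (e.equivFun.symm v)‖ ≤ _
    rw [hf, norm_mul, Complex.norm_real, Real.norm_of_nonneg (bump_nonneg hρ.le _ _ _)]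
    exact mul_le_of_le_one_left (bump_nonneg hρ.le _ _ _) (DirichletCharacter.norm_le_one ψ _)
  have hS : ‖∑' α, f α‖ ≤ D := by
    rw [← e.equivFun.symm.toEquiv.tsum_eq]
    have := hD s hs1 hs2
    simp_rw [← hf] at this
    exact this
  have hfib : ∀ I, ∑' α : (cofactor J ⁻¹' {I}), f α =
      (((M : ℝ) ^ (-s) * κ : ℝ) : ℂ) * classTerm J ψ s I := by
    intro I
    by_cases h : I ≠ ⊥ ∧ ∃ α, I * J = Ideal.span {α}
    · rw [classTerm, if_pos h]
      obtain ⟨hI, α, hα⟩ := h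
      have hαJ : α ∈ J := by
        rw [← Ideal.dvd_span_singleton, ← hα]; exact Dvd.intro_left I rfl
      have hα0 : α ≠ 0 := by
        rintro rfl
        rw [Ideal.span_singleton_zero (α := 𝓞 K)] at hα
        exact (mul_ne_zero hI hJ) hα
      have hα0' : algebraMap (𝓞 K) K α ≠ 0 := RingOfIntegers.coe_ne_zero_iff.mpr hα0
      rw [← (unitsEquivFiber hJ (α := ⟨α, hαJ⟩) hα0 hα).tsum_eq]
      have hterm : ∀ u : (𝓞 K)ˣ, f (unitsEquivFiber hJ (α := ⟨α, hαJ⟩) hα0 hα u) =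
          ((ψ (Ideal.absNorm I : ZMod q) * (((M * Ideal.absNorm I : ℝ) ^ (-s) : ℝ) : ℂ))) *
          (bump ρ 0 (σ₁ (algebraMap (𝓞 K) K u * algebraMap (𝓞 K) K α))
            (σ₂ (algebraMap (𝓞 K) K u * algebraMap (𝓞 K) K α)) : ℝ) := by
        intro u
        set β := unitsEquivFiber hJ (α := ⟨α, hαJ⟩) hα0 hα u with hβ
        have hβI : cofactor J β = I := β.2
        have hβv : algebraMap (𝓞 K) K (β : J) = algebraMap (𝓞 K) K u * algebraMap (𝓞 K) K α := by
          rw [← map_mul]; rfl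
        have hβ0 : algebraMap (𝓞 K) K (β : J) ≠ 0 := by
          rw [hβv]; exact mul_ne_zero (Units.coe_ne_zero u) hα0'
        simp only [f]
        rw [hβI, bump_eq_rpow_mul ((map_ne_zero σ₁).mpr hβ0) ((map_ne_zero σ₂).mpr hβ0), ← hi]
        have h1 : (M * Ideal.absNorm I : ℝ) = |((Algebra.norm ℤ ((β : J) : 𝓞 K) : ℤ) : ℝ)| := by
          have h2 := habs β
          rw [hβI] at h2
          exact_mod_cast h2
        rw [← h1, hβv]
        push_cast; ring
      simp_rw [hterm]
      rw [tsum_mul_left, ← Complex.ofReal_tsum, (hsum _ hα0').tsum_eq,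
        Real.mul_rpow (by positivity) (by positivity)]
      push_cast; ring
    · rw [classTerm, if_neg h, mul_zero]
      rw [← tsum_zero (α := ℂ) (β := (cofactor J ⁻¹' {I}))]
      refine tsum_congr fun ⟨α, hα⟩ => ?_
      rw [Set.mem_preimage, Set.mem_singleton_iff, cofactor_eq_iff hJ] at hα
      have hI : I = ⊥ := by
        by_contra hI
        exact h ⟨hI, _, hα⟩
      have hα0 : (α : 𝓞 K) = 0 := by
        rw [hI] at hα
        have : Ideal.span {(α : 𝓞 K)} = ⊥ := by rw [← hα]; simp
        simpa using this
      simp [f, hα0, bump_zero_zero]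
  have hS2 : ∑' α, f α = (((M : ℝ) ^ (-s) * κ : ℝ) : ℂ) * ∑' I, classTerm J ψ s I := by
    rw [← (hsumm.hasSum.tsum_fiberwise (cofactor J)).tsum_eq]
    simp_rw [hfib]
    rw [tsum_mul_left]
  have hM1 : (1 : ℝ) ≤ M := by exact_mod_cast hM0
  have hMs : (M : ℝ) ^ (-(2 : ℝ)) ≤ (M : ℝ) ^ (-s) :=
    Real.rpow_le_rpow_of_exponent_le hM1 (by linarith)
  rw [hS2, norm_mul, Complex.norm_real, Real.norm_of_nonneg (by positivity)] at hS
  rw [le_div_iff₀ hκ]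
  have hM2 : (M : ℝ) ^ (-(2 : ℝ)) * (M : ℝ) ^ 2 = 1 := by
    rw [← Real.rpow_natCast, ← Real.rpow_add (by positivity)]; norm_num
  set T := ‖∑' I, classTerm J ψ s I‖
  have hT : 0 ≤ T := norm_nonneg _
  calc T * κ = ((M : ℝ) ^ (-(2 : ℝ)) * κ * T) * M ^ 2 := by
        linear_combination -(T * κ) * hM2
    _ ≤ ((M : ℝ) ^ (-s) * κ * T) * M ^ 2 := by gcongr
    _ ≤ D * M ^ 2 := by gcongr

end QuadraticIdeals

lemma tsum_eq_tsum_fiber {X Y E : Type*} [NormedAddCommGroup E] [CompleteSpace E] (g : X → Y)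
    {f : X → E} (hf : Summable f) : ∑' x, f x = ∑' y, ∑' x : {x // g x = y}, f x := by
  rw [← (Equiv.sigmaFiberEquiv g).tsum_eq]
  exact ((Equiv.sigmaFiberEquiv g).summable_iff.mpr hf).tsum_sigma

lemma norm_character_eq_one {G : Type*} [Group G] [Finite G] (χ : G →* ℂˣ) (g : G) :
    ‖(χ g : ℂ)‖ = 1 := by
  refine Complex.norm_eq_one_of_pow_eq_one (n := Nat.card G) ?_ Nat.card_pos.ne'
  rw [← Units.val_pow_eq_pow_val, ← map_pow, pow_card_eq_one', map_one, Units.val_one]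

section Density

open Filter Topology

variable {X : Type*} {N : X → ℕ}

lemma sum_card_fiber_eq (hfin : ∀ n, {x | N x ≤ n}.Finite) (hN : ∀ x, 1 ≤ N x) (n : ℕ) :
    ∑ k ∈ Finset.Icc 1 n, Nat.card {x // N x = k} = Nat.card {x // N x ≤ n} := by
  classical
  have h1 : ∀ k ∈ Finset.Icc 1 n, Nat.card {x // N x = k} =
      ((hfin n).toFinset.filter (fun x => N x = k)).card := fun k hk => by
    refine Nat.subtype_card _ fun x => ?_
    simp only [Finset.mem_filter, Set.Finite.mem_toFinset, Set.mem_ofPred_eq]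
    have := (Finset.mem_Icc.mp hk).2
    exact ⟨fun h => h.2, fun h => ⟨by lia, h⟩⟩
  have h2 : Nat.card {x // N x ≤ n} = (hfin n).toFinset.card :=
    Nat.subtype_card _ fun x => by simp
  rw [Finset.sum_congr rfl h1, h2]
  refine (Finset.card_eq_sum_card_fiberwise fun x hx => ?_).symm
  simp only [Set.Finite.coe_toFinset, Set.mem_ofPred_eq] at hx
  simp [hN x, hx]

lemma finite_fiber (hfin : ∀ n, {x | N x ≤ n}.Finite) (k : ℕ) : Finite {x // N x = k} :=
  ((hfin k).subset fun _ h => le_of_eq h).to_subtype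

lemma tendsto_sum_card_fiber (hfin : ∀ n, {x | N x ≤ n}.Finite) (hN : ∀ x, 1 ≤ N x) {l : ℝ}
    (hl : Tendsto (fun t : ℝ => (Nat.card {x // (N x : ℝ) ≤ t} : ℝ) / t) atTop (𝓝 l)) :
    Tendsto (fun n : ℕ => (∑ k ∈ Finset.Icc 1 n, (Nat.card {x // N x = k} : ℝ)) / n) atTop
      (𝓝 l) := by
  refine (hl.comp tendsto_natCast_atTop_atTop).congr fun n => ?_
  simp only [Function.comp_apply, Nat.cast_le]
  rw [← sum_card_fiber_eq hfin hN]
  push_cast; rfl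

lemma tsum_fiber_rpow (hfin : ∀ n, {x | N x ≤ n}.Finite) (hN : ∀ x, 1 ≤ N x) (s : ℝ) (k : ℕ) :
    ((∑' x : {x // N x = k}, (N x : ℝ) ^ (-s) : ℝ) : ℂ) =
      LSeries.term (fun n => ((Nat.card {x // N x = n} : ℝ) : ℂ)) s k := by
  have := finite_fiber hfin k
  have := Fintype.ofFinite {x // N x = k}
  rw [tsum_congr (fun x : {x // N x = k} => by rw [x.2]), tsum_fintype]
  rcases eq_or_ne k 0 with rfl | hk
  · have : IsEmpty {x // N x = 0} := ⟨fun x => by have := hN x; lia⟩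
    simp
  · rw [LSeries.term_of_ne_zero hk, Finset.sum_const, Finset.card_univ, nsmul_eq_mul,
      Nat.card_eq_fintype_card, Real.rpow_neg (by positivity)]
    push_cast
    rw [Complex.ofReal_cpow (by positivity)]
    rfl

lemma LSeriesSummable_card_fiber (hfin : ∀ n, {x | N x ≤ n}.Finite) (hN : ∀ x, 1 ≤ N x) {l : ℝ}
    (hl : Tendsto (fun t : ℝ => (Nat.card {x // (N x : ℝ) ≤ t} : ℝ) / t) atTop (𝓝 l))
    {s : ℝ} (hs : 1 < s) :
    LSeriesSummable (fun n => ((Nat.card {x // N x = n} : ℝ) : ℂ)) s := by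
  refine LSeriesSummable_of_sum_norm_bigO_and_nonneg (r := 1) ?_ (fun _ => Nat.cast_nonneg _)
    zero_le_one (by simpa using hs)
  have := (tendsto_sum_card_fiber hfin hN hl).isBigO_one ℝ
  have h2 := this.mul (Asymptotics.isBigO_refl (fun n : ℕ => (n : ℝ)) atTop)
  refine (h2.congr' ?_ ?_)
  · filter_upwards [eventually_ne_atTop 0] with n hn
    field_simp
  · exact Eventually.of_forall fun n => by simp

lemma summable_rpow_of_tendsto_card (hfin : ∀ n, {x | N x ≤ n}.Finite) (hN : ∀ x, 1 ≤ N x) {l : ℝ}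
    (hl : Tendsto (fun t : ℝ => (Nat.card {x // (N x : ℝ) ≤ t} : ℝ) / t) atTop (𝓝 l))
    {s : ℝ} (hs : 1 < s) :
    Summable fun x => (N x : ℝ) ^ (-s) := by
  rw [← (Equiv.sigmaFiberEquiv N).summable_iff]
  have hfib : ∀ k, Finite {x // N x = k} := finite_fiber hfin
  rw [summable_sigma_of_nonneg]
  · refine ⟨fun k => Summable.of_finite, ?_⟩
    rw [← Complex.summable_ofReal]
    exact (LSeriesSummable_card_fiber hfin hN hl hs).congr fun k => (tsum_fiber_rpow hfin hN s k).symm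
  · intro x
    exact Real.rpow_nonneg (Nat.cast_nonneg _) _

theorem tendsto_sub_one_mul_tsum_rpow (hfin : ∀ n, {x | N x ≤ n}.Finite) (hN : ∀ x, 1 ≤ N x)
    {l : ℝ} (hl : Tendsto (fun t : ℝ => (Nat.card {x // (N x : ℝ) ≤ t} : ℝ) / t) atTop (𝓝 l)) :
    Tendsto (fun s : ℝ => (s - 1) * ∑' x, (N x : ℝ) ^ (-s)) (𝓝[>] 1) (𝓝 l) := by
  have h := LSeries_tendsto_sub_mul_nhds_one_of_tendsto_sum_div_and_nonneg _
    (tendsto_sum_card_fiber hfin hN hl) (fun _ => Nat.cast_nonneg _)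
  rw [← tendsto_ofReal_iff]
  refine h.congr' ?_
  filter_upwards [self_mem_nhdsWithin] with s hs
  rw [Complex.ofReal_mul, Complex.ofReal_sub, Complex.ofReal_one]
  congr 1
  have hsum := summable_rpow_of_tendsto_card hfin hN hl hs
  rw [LSeries, tsum_eq_tsum_fiber N hsum, Complex.ofReal_tsum]
  exact tsum_congr fun k => (tsum_fiber_rpow hfin hN s k).symm

end Density

section Ideals

open Filter Topology

variable (K : Type*) [Field K] [NumberField K]

lemma finite_setOf_absNorm_le' (n : ℕ) :
    {I : (Ideal (𝓞 K))⁰ | Ideal.absNorm (I : Ideal (𝓞 K)) ≤ n}.Finite :=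
  (Ideal.finite_setOfPred_absNorm_le n).preimage Subtype.val_injective.injOn

lemma one_le_absNorm (I : (Ideal (𝓞 K))⁰) : 1 ≤ Ideal.absNorm (I : Ideal (𝓞 K)) :=
  Nat.one_le_iff_ne_zero.mpr (Ideal.absNorm_ne_zero_of_nonZeroDivisors I)

lemma summable_absNorm_rpow {s : ℝ} (hs : 1 < s) :
    Summable fun I : (Ideal (𝓞 K))⁰ => (Ideal.absNorm (I : Ideal (𝓞 K)) : ℝ) ^ (-s) :=
  summable_rpow_of_tendsto_card (finite_setOf_absNorm_le' K) (one_le_absNorm K)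
    (Ideal.tendsto_norm_le_div_atTop₀ K) hs

lemma tendsto_sub_one_mul_tsum_absNorm_rpow : ∃ l : ℝ, 0 < l ∧
    Tendsto (fun s : ℝ => (s - 1) *
      ∑' I : (Ideal (𝓞 K))⁰, (Ideal.absNorm (I : Ideal (𝓞 K)) : ℝ) ^ (-s)) (𝓝[>] 1) (𝓝 l) :=
  ⟨dedekindZeta_residue K, dedekindZeta_residue_pos K,
    tendsto_sub_one_mul_tsum_rpow (finite_setOf_absNorm_le' K) (one_le_absNorm K)
    (Ideal.tendsto_norm_le_div_atTop₀ K)⟩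

lemma tendsto_sub_one_mul_tsum_class : ∃ l : ℝ, ∀ C : ClassGroup (𝓞 K),
    Tendsto (fun s : ℝ => (s - 1) *
      ∑' I : {I : (Ideal (𝓞 K))⁰ // ClassGroup.mk0 I = C},
        (Ideal.absNorm (I : Ideal (𝓞 K)) : ℝ) ^ (-s)) (𝓝[>] 1) (𝓝 l) := by
  obtain ⟨l, hl⟩ : ∃ l : ℝ, ∀ C : ClassGroup (𝓞 K), Tendsto (fun t : ℝ =>
      (Nat.card {I : (Ideal (𝓞 K))⁰ // (Ideal.absNorm (I : Ideal (𝓞 K)) : ℝ) ≤ t ∧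
        ClassGroup.mk0 I = C} : ℝ) / t) atTop (𝓝 l) :=
    ⟨_, Ideal.tendsto_norm_le_and_mk_eq_div_atTop K⟩
  refine ⟨l, fun C => tendsto_sub_one_mul_tsum_rpow
    (N := fun I : {I : (Ideal (𝓞 K))⁰ // ClassGroup.mk0 I = C} => Ideal.absNorm (I : Ideal (𝓞 K)))
    (fun n => ?_) (fun I => one_le_absNorm K I.1) ((hl C).congr fun t => ?_)⟩
  · exact (finite_setOf_absNorm_le' K n).preimage Subtype.val_injective.injOn
  · have e : {I : (Ideal (𝓞 K))⁰ // (Ideal.absNorm (I : Ideal (𝓞 K)) : ℝ) ≤ t ∧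
        ClassGroup.mk0 I = C} ≃ {I : {I : (Ideal (𝓞 K))⁰ // ClassGroup.mk0 I = C} //
          (Ideal.absNorm (I : Ideal (𝓞 K)) : ℝ) ≤ t} :=
      ⟨fun I => ⟨⟨I.1, I.2.2⟩, I.2.1⟩, fun I => ⟨I.1.1, I.2, I.1.2⟩, fun _ => rfl, fun _ => rfl⟩
    rw [Nat.card_congr e]

theorem tendsto_sub_one_mul_tsum_character (χ : ClassGroup (𝓞 K) →* ℂˣ) (hχ : χ ≠ 1) :
    Tendsto (fun s : ℝ => ((s - 1 : ℝ) : ℂ) *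
      ∑' I : (Ideal (𝓞 K))⁰, (χ (ClassGroup.mk0 I) : ℂ) *
        (((Ideal.absNorm (I : Ideal (𝓞 K)) : ℝ) ^ (-s) : ℝ) : ℂ)) (𝓝[>] 1) (𝓝 0) := by
  obtain ⟨l, hl⟩ := tendsto_sub_one_mul_tsum_class K
  have hsum0 : ∑ C, (χ C : ℂ) = 0 := by
    have h0 : (Units.coeHom ℂ).comp χ ≠ 1 := fun h => hχ <| by
      ext C
      simpa using DFunLike.congr_fun h C
    simpa using sum_hom_units_eq_zero _ h0
  have h1 : Tendsto (fun s : ℝ => ∑ C, (χ C : ℂ) * (((s - 1) *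
      ∑' I : {I : (Ideal (𝓞 K))⁰ // ClassGroup.mk0 I = C},
        (Ideal.absNorm (I : Ideal (𝓞 K)) : ℝ) ^ (-s) : ℝ) : ℂ)) (𝓝[>] 1) (𝓝 (∑ C, (χ C : ℂ) * l)) :=
    tendsto_finsetSum _ fun C _ => ((tendsto_ofReal_iff.mpr (hl C)).const_mul _)
  rw [← Finset.sum_mul, hsum0, zero_mul] at h1
  refine h1.congr' ?_
  filter_upwards [self_mem_nhdsWithin] with s hs
  have hsm := summable_absNorm_rpow K hs
  have hsm2 : Summable fun I : (Ideal (𝓞 K))⁰ => (χ (ClassGroup.mk0 I) : ℂ) *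
      (((Ideal.absNorm (I : Ideal (𝓞 K)) : ℝ) ^ (-s) : ℝ) : ℂ) := by
    refine Summable.of_norm_bounded hsm fun I => ?_
    rw [norm_mul, norm_character_eq_one, one_mul, Complex.norm_real, Real.norm_of_nonneg]
    exact Real.rpow_nonneg (Nat.cast_nonneg _) _
  rw [tsum_eq_tsum_fiber (fun I => ClassGroup.mk0 I) hsm2, tsum_fintype, Finset.mul_sum]
  refine Finset.sum_congr rfl fun C _ => ?_
  push_cast
  rw [mul_left_comm, ← tsum_mul_left]
  congr 1
  refine tsum_congr fun I => ?_
  rw [I.2]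

end Ideals

section EulerProduct

open Filter Topology IsDedekindDomain

variable {R : Type*} [CommRing R] [IsDedekindDomain R]

lemma tsum_mul_prod_one_sub {f : Ideal R →*₀ ℂ} (hf : Summable fun I => ‖f I‖)
    (S : Finset (HeightOneSpectrum R)) :
    (∑' I, f I) * ∏ v ∈ S, (1 - f v.asIdeal) =
      ∑' I, Set.indicator {I | ∀ v ∈ S, ¬ v.asIdeal ∣ I} f I := by
  classical
  induction S using Finset.induction_on with
  | empty => simp
  | insert v S hv ih =>
    have hs : ∀ T : Set (Ideal R), Summable (T.indicator f) := fun T => hf.of_norm.indicator T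
    rw [Finset.prod_insert hv, mul_left_comm, ih, sub_mul, one_mul]
    set A := {I : Ideal R | ∀ v ∈ S, ¬ v.asIdeal ∣ I} with hA
    have hinj : Function.Injective fun J : Ideal R => v.asIdeal * J :=
      mul_right_injective₀ v.ne_bot
    have h1 : f v.asIdeal * ∑' I, A.indicator f I =
        ∑' I, Set.indicator (A ∩ {I | v.asIdeal ∣ I}) f I := by
      rw [← tsum_mul_left, ← hinj.tsum_eq (f := Set.indicator (A ∩ {I | v.asIdeal ∣ I}) f)]
      · refine tsum_congr fun J => ?_
        have : v.asIdeal * J ∈ A ∩ {I | v.asIdeal ∣ I} ↔ J ∈ A := by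
          refine ⟨fun h w hw hwJ => h.1 w hw (hwJ.mul_left _), fun h => ⟨fun w hw hwJ => ?_,
            dvd_mul_right _ _⟩⟩
          rcases w.prime.dvd_or_dvd hwJ with h' | h'
          · refine hv ?_
            have : v = w := HeightOneSpectrum.ext (v.isMaximal.eq_of_le w.isPrime.ne_top
              (Ideal.dvd_iff_le.mp h'))
            rwa [this]
          · exact h w hw h'
        by_cases hJ : J ∈ A
        · rw [Set.indicator_of_mem hJ, Set.indicator_of_mem (this.mpr hJ), map_mul]
        · rw [Set.indicator_of_notMem hJ, Set.indicator_of_notMem (mt this.mp hJ), mul_zero]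
      · intro I hI
        obtain ⟨J, rfl⟩ := (Set.mem_of_indicator_ne_zero hI).2
        exact ⟨J, rfl⟩
    rw [h1, ← (hs _).tsum_sub (hs _)]
    refine tsum_congr fun I => ?_
    have hm : I ∈ {I | ∀ w ∈ insert v S, ¬ w.asIdeal ∣ I} ↔ I ∈ A ∧ ¬ v.asIdeal ∣ I := by
      simp [hA, and_comm]
    have hm2 : I ∈ A ∩ {I | v.asIdeal ∣ I} ↔ I ∈ A ∧ v.asIdeal ∣ I := Iff.rfl
    generalize {I : Ideal R | ∀ w ∈ insert v S, ¬ w.asIdeal ∣ I} = B at hm ⊢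
    generalize A ∩ {I | v.asIdeal ∣ I} = B' at hm2 ⊢
    by_cases h2 : I ∈ A <;> by_cases h3 : v.asIdeal ∣ I <;>
      simp [Set.indicator, hm, hm2, h2, h3]

theorem tendsto_tsum_mul_prod_one_sub {f : Ideal R →*₀ ℂ} (hf : Summable fun I => ‖f I‖) :
    Tendsto (fun S : Finset (HeightOneSpectrum R) => (∑' I, f I) * ∏ v ∈ S, (1 - f v.asIdeal))
      atTop (𝓝 1) := by
  classical
  simp_rw [tsum_mul_prod_one_sub hf]
  have h1 : ∑' I : Ideal R, (if I = 1 then (1 : ℂ) else 0) = 1 := by simp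
  rw [← h1]
  refine tendsto_tsum_of_dominated_convergence hf (fun I => ?_)
    (Eventually.of_forall fun S I => norm_indicator_le_norm_self _ _)
  refine tendsto_const_nhds.congr' ?_
  rcases eq_or_ne I 0 with rfl | hI0
  · refine Eventually.of_forall fun S => ?_
    have : f (0 : Ideal R) = 0 := map_zero f
    simp only [Set.indicator, this, ite_self]
    simp
  rcases eq_or_ne I 1 with rfl | hI1
  · refine Eventually.of_forall fun S => ?_
    beta_reduce
    rw [Set.indicator_of_mem]
    · rw [if_pos rfl, map_one]
    · exact fun v _ h => v.prime.not_isUnit (isUnit_of_dvd_one h)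
  · obtain ⟨M, hM, hIM⟩ := Ideal.exists_le_maximal I (by rwa [← Ideal.one_eq_top])
    have hM0 : M ≠ ⊥ := fun h => hI0 (by rw [h] at hIM; exact le_bot_iff.mp hIM)
    filter_upwards [eventually_ge_atTop {(⟨M, hM.isPrime, hM0⟩ : HeightOneSpectrum R)}] with S hS
    rw [if_neg hI1, Set.indicator_of_notMem]
    exact fun h => h _ (hS (Finset.mem_singleton_self _)) (Ideal.dvd_iff_le.mpr hIM)

end EulerProduct

section Frobenius

lemma exists_frobenius (K : Type*) {F : Type*} [Field K] [NumberField K] [Field F] [NumberField F]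
    [Algebra K F] [IsGalois K F] (Q : Ideal (𝓞 F)) [Q.IsPrime] (hQ : Q ≠ ⊥) :
    ∃ σ : Gal(F/K), (∀ x : 𝓞 F, σ • x - x ^ Ideal.absNorm (Q.under (𝓞 K)) ∈ Q) ∧
      ∀ (ζ : 𝓞 F) (m : ℕ), ζ ^ m = 1 → (m : 𝓞 F) ∉ Q →
        σ • ζ = ζ ^ Ideal.absNorm (Q.under (𝓞 K)) := by
  have : Finite (𝓞 F ⧸ Q) := Ideal.finiteQuotientOfFreeOfNeBot Q hQ
  obtain ⟨σ, hσ⟩ := IsArithFrobAt.exists_of_isInvariant (𝓞 K) (Gal(F/K)) Q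
  exact ⟨σ, fun x => hσ x, fun ζ m h hm => hσ.apply_of_pow_eq_one h hm⟩

lemma card_le_of_forall_pow_eq {k : Type*} [Field k] {n : ℕ} (hn : 1 < n)
    (h : ∀ x : k, x ^ n = x) : Nat.card k ≤ n := by
  classical
  have hp : (Polynomial.X ^ n - Polynomial.X : Polynomial k) ≠ 0 :=
    FiniteField.X_pow_card_sub_X_ne_zero k hn
  have hr : ∀ x : k, x ∈ (Polynomial.X ^ n - Polynomial.X : Polynomial k).roots.toFinset := by
    intro x
    simp [Polynomial.mem_roots hp, h x]
  let _ : Fintype k := ⟨_, hr⟩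
  calc Nat.card k = (Finset.univ : Finset k).card := Nat.card_eq_fintype_card
    _ ≤ (Polynomial.X ^ n - Polynomial.X : Polynomial k).roots.toFinset.card :=
        Finset.card_le_card fun x _ => hr x
    _ ≤ (Polynomial.X ^ n - Polynomial.X : Polynomial k).roots.card := Multiset.toFinset_card_le _
    _ ≤ (Polynomial.X ^ n - Polynomial.X : Polynomial k).natDegree := Polynomial.card_roots' _
    _ = n := FiniteField.X_pow_card_sub_X_natDegree_eq k hn

variable {K L F : Type*} [Field K] [NumberField K] [Field L] [NumberField L] [Field F]
  [NumberField F] [Algebra K L] [Algebra L F] [Algebra K F] [IsScalarTower K L F] [IsGalois K F]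
  {ζ : 𝓞 F} {q : ℕ} {ψ : MulChar (ZMod q) ℂ}

omit [NumberField K] [IsGalois K F] [NumberField F] in
lemma apply_absNorm_eq_one [NumberField F] [IsGalois L F] (hζ : ζ ^ q = 1)
    (hψ : ∀ (σ : Gal(F/K)) (a : ℕ), σ • ζ = ζ ^ a →
      (ψ a = 1 ↔ ∀ x : 𝓞 L, σ • algebraMap (𝓞 L) (𝓞 F) x = algebraMap (𝓞 L) (𝓞 F) x))
    (P : Ideal (𝓞 L)) [P.IsPrime] (hP : P ≠ ⊥) (hq : (q : 𝓞 L) ∉ P) :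
    ψ (Ideal.absNorm P : ℕ) = 1 := by
  have : P.IsMaximal := Ideal.IsPrime.isMaximal ‹_› hP
  obtain ⟨Q, hQ, hQP⟩ := Ideal.exists_maximal_ideal_liesOver_of_isIntegral (S := 𝓞 F) P
  have hQ0 : Q ≠ ⊥ := Ideal.ne_bot_of_liesOver_of_ne_bot hP Q
  obtain ⟨σ, -, h2⟩ := exists_frobenius L Q hQ0
  rw [← hQP.over] at h2
  refine (hψ (σ.restrictScalars K) _ (h2 ζ q hζ ?_)).mpr fun x => ?_
  · intro h
    apply hq
    rw [hQP.over, Ideal.mem_comap, map_natCast]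
    exact h
  · exact smul_algebraMap σ x

lemma absNorm_eq_of_apply_eq_one (hζ : ζ ^ q = 1)
    (hψ : ∀ (σ : Gal(F/K)) (a : ℕ), σ • ζ = ζ ^ a →
      (ψ a = 1 ↔ ∀ x : 𝓞 L, σ • algebraMap (𝓞 L) (𝓞 F) x = algebraMap (𝓞 L) (𝓞 F) x))
    (p : Ideal (𝓞 K)) [p.IsPrime] (hp : p ≠ ⊥) (hq : (q : 𝓞 K) ∉ p)
    (h1 : ψ (Ideal.absNorm p : ℕ) = 1) (P : Ideal (𝓞 L)) [P.IsPrime] [hPp : P.LiesOver p] :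
    P.inertiaDeg (𝓞 K) = 1 := by
  have hP : P ≠ ⊥ := Ideal.ne_bot_of_liesOver_of_ne_bot hp P
  have : P.IsMaximal := Ideal.IsPrime.isMaximal ‹_› hP
  obtain ⟨Q, hQ, hQP⟩ := Ideal.exists_maximal_ideal_liesOver_of_isIntegral (S := 𝓞 F) P
  have hQ0 : Q ≠ ⊥ := Ideal.ne_bot_of_liesOver_of_ne_bot hP Q
  have hQp : Q.LiesOver p := Ideal.LiesOver.trans Q P p
  obtain ⟨σ, h3, h2⟩ := exists_frobenius K Q hQ0
  rw [← hQp.over] at h2 h3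
  have hfix := (hψ σ _ (h2 ζ q hζ fun h => hq (by
    rw [hQp.over, Ideal.mem_comap, map_natCast]; exact h))).mp h1
  have hp1 : 1 < Ideal.absNorm p := by
    have h0 := Ideal.absNorm_eq_zero_iff.not.mpr hp
    have h1 := Ideal.absNorm_eq_one_iff.not.mpr (Ideal.IsPrime.ne_top ‹p.IsPrime›)
    lia
  have hle : Ideal.absNorm P ≤ Ideal.absNorm p := by
    rw [Ideal.absNorm_apply, Submodule.cardQuot_apply]
    let _ := Ideal.Quotient.field P
    refine card_le_of_forall_pow_eq (k := 𝓞 L ⧸ P) hp1 fun x => ?_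
    obtain ⟨x, rfl⟩ := Ideal.Quotient.mk_surjective x
    rw [← map_pow, eq_comm, Ideal.Quotient.eq, hQP.over, Ideal.mem_comap, map_sub, map_pow]
    have := h3 (algebraMap _ _ x)
    rwa [hfix] at this
  rw [← Ideal.absNorm_pow_inertiaDeg p P] at hle
  have := (Nat.pow_le_pow_iff_right hp1).mp (hle.trans (pow_one _).ge)
  have := Ideal.inertiaDeg_pos P (𝓞 K)
  lia

end Frobenius

section LocalFactors

lemma prod_range_one_sub_pow_mul {w c : ℂ} {ℓ : ℕ} (hℓ : 0 < ℓ) (hw : IsPrimitiveRoot w ℓ)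
    (hc : c ^ ℓ = 1) (x : ℂ) : ∏ j ∈ Finset.range ℓ, (1 - c * w ^ j * x) = 1 - x ^ ℓ := by
  have h := congrArg (Polynomial.eval 1) (X_pow_sub_C_eq_prod hw hℓ
    (show (c * x) ^ ℓ = x ^ ℓ by rw [mul_pow, hc, one_mul]))
  simp only [Polynomial.eval_sub, Polynomial.eval_pow, Polynomial.eval_X, Polynomial.eval_C,
    one_pow, Polynomial.eval_prod] at h
  rw [h]
  exact Finset.prod_congr rfl fun j _ => by ring

variable {K L F : Type*} [Field K] [NumberField K] [Field L] [NumberField L] [Field F]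
  [NumberField F] [Algebra K L] [Algebra L F] [Algebra K F] [IsScalarTower K L F] [IsGalois K F]
  {ζ : 𝓞 F} {q : ℕ} {ψ : MulChar (ZMod q) ℂ} {ℓ : ℕ}

lemma sum_ramificationIdx_mul_inertiaDeg (hL : finrank K L = ℓ) (p : Ideal (𝓞 K)) [p.IsMaximal] :
    ∑ P : p.primesOver (𝓞 L), P.1.ramificationIdx (𝓞 K) * P.1.inertiaDeg (𝓞 K) = ℓ := by
  rw [← hL, IsFractionRing.finrank_eq (𝓞 K) K (𝓞 L) L]
  exact Ideal.sum_ramification_inertia_eq_finrank p (𝓞 L)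

lemma card_primesOver_mul_le (hL : finrank K L = ℓ) (p : Ideal (𝓞 K)) [p.IsMaximal]
    {m : ℕ} (hm : ∀ P : p.primesOver (𝓞 L), m ≤ P.1.inertiaDeg (𝓞 K)) :
    Fintype.card (p.primesOver (𝓞 L)) * m ≤ ℓ := by
  rw [← sum_ramificationIdx_mul_inertiaDeg hL p, ← smul_eq_mul, ← Finset.card_univ]
  refine Finset.card_nsmul_le_sum _ _ _ fun P _ => (hm P).trans (Nat.le_mul_of_pos_left _ ?_)
  exact P.1.ramificationIdx_pos (𝓞 K)

lemma pow_card_le_prod_primesOver (p : Ideal (𝓞 K)) [p.IsMaximal] (s : ℝ) 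
    {m : ℕ} (hm : ∀ P : p.primesOver (𝓞 L), m ≤ P.1.inertiaDeg (𝓞 K))
    (hx : (Ideal.absNorm p : ℝ) ^ (-s) ≤ 1) :
    (1 - ((Ideal.absNorm p : ℝ) ^ (-s)) ^ m) ^ Fintype.card (p.primesOver (𝓞 L)) ≤
      ∏ P : p.primesOver (𝓞 L), (1 - (Ideal.absNorm P.1 : ℝ) ^ (-s)) := by
  have hx0 : 0 ≤ (Ideal.absNorm p : ℝ) ^ (-s) := Real.rpow_nonneg (Nat.cast_nonneg _) _
  rw [← Finset.card_univ, ← Finset.prod_const]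
  refine Finset.prod_le_prod (fun P _ => sub_nonneg.mpr (pow_le_one₀ hx0 hx)) fun P _ => ?_
  have : P.1.IsPrime := P.2.1
  have : P.1.LiesOver p := P.2.2
  rw [← Ideal.absNorm_pow_inertiaDeg p P.1, Nat.cast_pow, ← Real.rpow_natCast_mul (by positivity),
    mul_comm, Real.rpow_mul_natCast (by positivity)]
  exact sub_le_sub_left (pow_le_pow_of_le_one hx0 hx (hm P)) 1

theorem norm_prod_one_sub_le (hℓ : ℓ.Prime) (hL : finrank K L = ℓ) (hζ : ζ ^ q = 1)
    (hψ : ∀ (σ : Gal(F/K)) (a : ℕ), σ • ζ = ζ ^ a →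
      (ψ a = 1 ↔ ∀ x : 𝓞 L, σ • algebraMap (𝓞 L) (𝓞 F) x = algebraMap (𝓞 L) (𝓞 F) x))
    (hψℓ : ψ ^ ℓ = 1) {X : Ideal (𝓞 K) →*₀ ℂ}
    (hX : ∀ P : Ideal (𝓞 L), P ≠ ⊥ → X (Ideal.relNorm (𝓞 K) P) = 1)
    (p : Ideal (𝓞 K)) [p.IsMaximal] (hp : p ≠ ⊥) (hq : (q : 𝓞 K) ∉ p) {s : ℝ} (hs : 0 ≤ s) :
    ‖∏ j ∈ Finset.range ℓ, (1 - X p * ψ (Ideal.absNorm p : ℕ) ^ j *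
        (((Ideal.absNorm p : ℝ) ^ (-s) : ℝ) : ℂ))‖ ≤
      ∏ P : p.primesOver (𝓞 L), (1 - (Ideal.absNorm P.1 : ℝ) ^ (-s)) := by
  have hN : 1 ≤ (Ideal.absNorm p : ℝ) := by
    exact_mod_cast Nat.one_le_iff_ne_zero.mpr (Ideal.absNorm_eq_zero_iff.not.mpr hp)
  have hx : (Ideal.absNorm p : ℝ) ^ (-s) ≤ 1 :=
    Real.rpow_le_one_of_one_le_of_nonpos hN (neg_nonpos.mpr hs)
  have hx0 : 0 ≤ (Ideal.absNorm p : ℝ) ^ (-s) := Real.rpow_nonneg (Nat.cast_nonneg _) _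
  obtain ⟨P₀, hP₀, hP₀p⟩ := Ideal.exists_maximal_ideal_liesOver_of_isIntegral (S := 𝓞 L) p
  have hP0 : P₀ ≠ ⊥ := Ideal.ne_bot_of_liesOver_of_ne_bot hp P₀
  have hpos : ∀ P : p.primesOver (𝓞 L), 1 ≤ P.1.inertiaDeg (𝓞 K) := fun P =>
    have : P.1.IsPrime := P.2.1
    Ideal.inertiaDeg_pos P.1 (𝓞 K)
  by_cases h1 : ψ (Ideal.absNorm p : ℕ) = 1
  · have hX1 : X p = 1 := by
      rw [← hX P₀ hP0, Ideal.relNorm_eq_pow_of_isMaximal P₀ p,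
        absNorm_eq_of_apply_eq_one hζ hψ p hp hq h1 P₀, pow_one]
    have hcard := card_primesOver_mul_le (L := L) hL p hpos
    refine le_trans ?_ (pow_card_le_prod_primesOver p s hpos hx)
    rw [pow_one, h1, hX1]
    simp only [one_pow, one_mul, Finset.prod_const, Finset.card_range, norm_pow]
    rw [← Complex.ofReal_one, ← Complex.ofReal_sub, Complex.norm_real,
      Real.norm_of_nonneg (sub_nonneg.mpr hx)]
    exact pow_le_pow_of_le_one (sub_nonneg.mpr hx) (sub_le_self _ hx0) (by lia)
  · have hw : ∀ P : Ideal (𝓞 L), P.IsPrime → P.LiesOver p →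
        ψ (Ideal.absNorm p : ℕ) ^ P.inertiaDeg (𝓞 K) = 1 := fun P _ hPp => by
      have hqP : (q : 𝓞 L) ∉ P := fun h => hq (by
        rw [hPp.over, Ideal.mem_comap, map_natCast]; exact h)
      have := IsGalois.tower_top_of_isGalois K L F
      have h := apply_absNorm_eq_one (K := K) hζ hψ P (Ideal.ne_bot_of_liesOver_of_ne_bot hp P) hqP
      rwa [← Ideal.absNorm_pow_inertiaDeg p P, Nat.cast_pow, map_pow] at h
    have hwℓ : ψ (Ideal.absNorm p : ℕ) ^ ℓ = 1 := by
      have h0 : ψ (Ideal.absNorm p : ℕ) ≠ 0 := fun h0 => by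
        have := hw P₀ hP₀.isPrime hP₀p
        rw [h0, zero_pow (Ideal.inertiaDeg_pos P₀ (𝓞 K)).ne'] at this
        exact zero_ne_one this
      rw [← MulChar.pow_apply' _ hℓ.ne_zero, hψℓ, MulChar.one_apply]
      by_contra hu
      exact h0 (ψ.map_nonunit hu)
    have hprim : IsPrimitiveRoot (ψ (Ideal.absNorm p : ℕ)) ℓ := by
      have := Fact.mk hℓ
      exact IsPrimitiveRoot.iff_orderOf.mpr (orderOf_eq_prime hwℓ h1)
    have hdeg : ∀ P : p.primesOver (𝓞 L), ℓ ≤ P.1.inertiaDeg (𝓞 K) := fun P =>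
      Nat.le_of_dvd (hpos P) ((hprim.pow_eq_one_iff_dvd _).mp (hw P.1 P.2.1 P.2.2))
    have hcard := card_primesOver_mul_le (L := L) hL p hdeg
    have hcard1 : Fintype.card (p.primesOver (𝓞 L)) ≤ 1 :=
      Nat.le_of_mul_le_mul_right (by simpa using hcard) hℓ.pos
    have hXℓ : X p ^ ℓ = 1 := by
      rw [← hX (p.map (algebraMap (𝓞 K) (𝓞 L))) (Ideal.map_ne_bot_of_ne_bot hp),
        Ideal.relNorm_algebraMap, ← IsFractionRing.finrank_eq (𝓞 K) K (𝓞 L) L, hL, map_pow]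
    refine le_trans ?_ (pow_card_le_prod_primesOver p s hdeg hx)
    rw [prod_range_one_sub_pow_mul hℓ.pos hprim hXℓ, ← Complex.ofReal_pow, ← Complex.ofReal_one,
      ← Complex.ofReal_sub, Complex.norm_real,
      Real.norm_of_nonneg (sub_nonneg.mpr (pow_le_one₀ hx0 hx))]
    calc _ = (1 - ((Ideal.absNorm p : ℝ) ^ (-s)) ^ ℓ) ^ 1 := (pow_one _).symm
      _ ≤ _ := pow_le_pow_of_le_one (sub_nonneg.mpr (pow_le_one₀ hx0 hx))
        (sub_le_self _ (pow_nonneg hx0 _)) hcard1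

theorem norm_prod_one_sub_le_of_mem (hq' : q.Prime) (hℓ : 0 < ℓ) (hL : finrank K L = ℓ)
    (ψ : MulChar (ZMod q) ℂ) {X : Ideal (𝓞 K) →*₀ ℂ} (p : Ideal (𝓞 K)) [p.IsMaximal] (hp : p ≠ ⊥)
    (hX : ‖X p‖ ≤ 1) (hq : (q : 𝓞 K) ∈ p) {s : ℝ} (hs : 1 ≤ s) :
    ‖∏ j ∈ Finset.range ℓ, (1 - X p * ψ (Ideal.absNorm p : ℕ) ^ j *
        (((Ideal.absNorm p : ℝ) ^ (-s) : ℝ) : ℂ))‖ ≤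
      2 ^ (ℓ + 1) * ∏ P : p.primesOver (𝓞 L), (1 - (Ideal.absNorm P.1 : ℝ) ^ (-s)) := by
  have hN1 : Ideal.absNorm p ≠ 1 := Ideal.absNorm_eq_one_iff.not.mpr Ideal.IsPrime.ne_top'
  have hN0 : Ideal.absNorm p ≠ 0 := Ideal.absNorm_eq_zero_iff.not.mpr hp
  have hN2 : (2 : ℝ) ≤ Ideal.absNorm p := by
    exact_mod_cast (show 2 ≤ Ideal.absNorm p by lia)
  have hx : (Ideal.absNorm p : ℝ) ^ (-s) ≤ 1 / 2 := by
    calc _ ≤ (Ideal.absNorm p : ℝ) ^ (-1 : ℝ) :=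
          Real.rpow_le_rpow_of_exponent_le (by linarith) (by linarith)
      _ = (Ideal.absNorm p : ℝ)⁻¹ := Real.rpow_neg_one _
      _ ≤ 1 / 2 := by rw [one_div]; gcongr
  have hx0 : 0 ≤ (Ideal.absNorm p : ℝ) ^ (-s) := Real.rpow_nonneg (Nat.cast_nonneg _) _
  have hψ0 : ψ (Ideal.absNorm p : ℕ) = 0 := by
    have hdvd : Ideal.absNorm p ∣ q ^ finrank ℤ (𝓞 K) := by
      rw [← Ideal.absNorm_span_natCast (S := 𝓞 K)]
      exact Ideal.absNorm_dvd_absNorm_of_le ((Ideal.span_singleton_le_iff_mem _).mpr hq)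
    obtain ⟨k, -, hk⟩ := (Nat.dvd_prime_pow hq').mp hdvd
    have hk0 : k ≠ 0 := by rintro rfl; exact hN1 (by simpa using hk)
    have := Fact.mk hq'
    rw [hk, Nat.cast_pow, ZMod.natCast_self, zero_pow hk0, MulChar.map_zero]
  obtain ⟨ℓ, rfl⟩ := Nat.exists_eq_add_one_of_ne_zero hℓ.ne'
  have hpos : ∀ P : p.primesOver (𝓞 L), 1 ≤ P.1.inertiaDeg (𝓞 K) := fun P =>
    have : P.1.IsPrime := P.2.1
    Ideal.inertiaDeg_pos P.1 (𝓞 K)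
  have hcard := card_primesOver_mul_le (L := L) hL p hpos
  have h1 : (2⁻¹ : ℝ) ^ (ℓ + 1) ≤
      ∏ P : p.primesOver (𝓞 L), (1 - (Ideal.absNorm P.1 : ℝ) ^ (-s)) := by
    refine le_trans ?_ (pow_card_le_prod_primesOver p s hpos (by linarith))
    calc (2⁻¹ : ℝ) ^ (ℓ + 1) ≤ 2⁻¹ ^ Fintype.card (p.primesOver (𝓞 L)) :=
          pow_le_pow_of_le_one (by norm_num) (by norm_num) (by simpa using hcard)
      _ ≤ _ := pow_le_pow_left₀ (by norm_num) (by rw [pow_one]; linarith) _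
  rw [Finset.prod_range_succ', hψ0]
  simp only [zero_pow (Nat.succ_ne_zero _), mul_zero, zero_mul, sub_zero, Finset.prod_const_one,
    one_mul, pow_zero, mul_one]
  calc _ ≤ 1 + ‖X p * (((Ideal.absNorm p : ℝ) ^ (-s) : ℝ) : ℂ)‖ := by
        exact (norm_sub_le _ _).trans_eq (by rw [norm_one])
    _ ≤ 1 + 1 * 1 := by
        rw [norm_mul, Complex.norm_real, Real.norm_of_nonneg hx0]
        gcongr
        linarith
    _ = 2 ^ (ℓ + 1 + 1) * 2⁻¹ ^ (ℓ + 1) := by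
        rw [pow_succ, mul_right_comm, ← mul_pow]; norm_num
    _ ≤ _ := by gcongr

end LocalFactors

section TwistedTerm

open Filter Topology

variable {K : Type*} [Field K] [NumberField K]

/-- A class group character as a function on ideals, vanishing at the zero ideal. -/
def idealChar (χ : ClassGroup (𝓞 K) →* ℂˣ) : Ideal (𝓞 K) →*₀ ℂ := by
  classical exact
  { toFun := fun I => if h : I = ⊥ then 0 else
      (χ (ClassGroup.mk0 ⟨I, mem_nonZeroDivisors_of_ne_zero h⟩) : ℂ)
    map_zero' := by simp
    map_one' := by
      rw [dif_neg (by simp)]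
      have : ClassGroup.mk0 ⟨(1 : Ideal (𝓞 K)), mem_nonZeroDivisors_of_ne_zero (by simp)⟩ = 1 :=
        map_one ClassGroup.mk0
      rw [this, map_one, Units.val_one]
    map_mul' := fun I J => by
      rcases eq_or_ne I ⊥ with rfl | hI
      · simp
      rcases eq_or_ne J ⊥ with rfl | hJ
      · simp
      have hIJ : I * J ≠ ⊥ := mul_ne_zero hI hJ
      rw [dif_neg hI, dif_neg hJ, dif_neg hIJ, ← Units.val_mul, ← map_mul, ← map_mul]
      rfl }

lemma idealChar_apply (χ : ClassGroup (𝓞 K) →* ℂˣ) (I : (Ideal (𝓞 K))⁰) :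
    idealChar χ I = χ (ClassGroup.mk0 I) := by
  have : (I : Ideal (𝓞 K)) ≠ ⊥ := nonZeroDivisors.coe_ne_zero I
  simp [idealChar, this]

lemma norm_idealChar_le (χ : ClassGroup (𝓞 K) →* ℂˣ) (I : Ideal (𝓞 K)) :
    ‖idealChar χ I‖ ≤ 1 := by
  rcases eq_or_ne I ⊥ with rfl | hI
  · have : idealChar χ (⊥ : Ideal (𝓞 K)) = 0 := map_zero _
    simp [this]
  · rw [show I = ((⟨I, mem_nonZeroDivisors_of_ne_zero hI⟩ : (Ideal (𝓞 K))⁰) : Ideal (𝓞 K)) from rfl,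
      idealChar_apply, norm_character_eq_one]

/-- The Dirichlet series term of `χ` twisted by the `j`-th power of `ψ` composed with the norm. -/
def twistedTerm (χ : ClassGroup (𝓞 K) →* ℂˣ) {q : ℕ} (ψ : MulChar (ZMod q) ℂ) (j : ℕ) (s : ℝ) :
    Ideal (𝓞 K) →*₀ ℂ where
  toFun I := idealChar χ I * ψ (Ideal.absNorm I : ℕ) ^ j * (((Ideal.absNorm I : ℝ) ^ (-s) : ℝ) : ℂ)
  map_zero' := by rw [map_zero, zero_mul, zero_mul]
  map_one' := by rw [map_one, map_one]; simp
  map_mul' I J := by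
    simp only [map_mul, Nat.cast_mul]
    rw [Real.mul_rpow (Nat.cast_nonneg _) (Nat.cast_nonneg _)]
    push_cast
    ring

variable (χ : ClassGroup (𝓞 K) →* ℂˣ) {q : ℕ} (ψ : MulChar (ZMod q) ℂ) {j : ℕ} {s : ℝ}

lemma twistedTerm_apply (I : Ideal (𝓞 K)) : twistedTerm χ ψ j s I =
    idealChar χ I * ψ (Ideal.absNorm I : ℕ) ^ j * (((Ideal.absNorm I : ℝ) ^ (-s) : ℝ) : ℂ) := rfl

lemma twistedTerm_one_apply (I : (Ideal (𝓞 K))⁰) :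
    twistedTerm 1 (1 : MulChar (ZMod 1) ℂ) 0 s (I : Ideal (𝓞 K)) =
      (((Ideal.absNorm (I : Ideal (𝓞 K)) : ℝ) ^ (-s) : ℝ) : ℂ) := by
  rw [twistedTerm_apply, idealChar_apply]
  simp

omit [NumberField K] in
lemma support_subset_range_val (f : Ideal (𝓞 K) →*₀ ℂ) :
    Function.support f ⊆ Set.range (Subtype.val : (Ideal (𝓞 K))⁰ → Ideal (𝓞 K)) := fun I hI =>
  ⟨⟨I, mem_nonZeroDivisors_of_ne_zero fun h => hI (by rw [h, map_zero])⟩, rfl⟩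

lemma summable_norm_twistedTerm (hs : 1 < s) : Summable fun I => ‖twistedTerm χ ψ j s I‖ := by
  rw [← (Subtype.val_injective (p := fun I => I ∈ (Ideal (𝓞 K))⁰)).summable_iff]
  · refine Summable.of_nonneg_of_le (fun _ => norm_nonneg _) (fun I => ?_) (summable_absNorm_rpow K hs)
    rw [Function.comp_apply, twistedTerm_apply, norm_mul, norm_mul, norm_pow, Complex.norm_real,
      Real.norm_of_nonneg (Real.rpow_nonneg (Nat.cast_nonneg _) _)]
    refine mul_le_of_le_one_left (Real.rpow_nonneg (Nat.cast_nonneg _) _) ?_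
    exact mul_le_one₀ (norm_idealChar_le _ _) (by positivity)
      (pow_le_one₀ (norm_nonneg _) (DirichletCharacter.norm_le_one ψ _))
  · intro I hI
    by_contra h
    exact hI (support_subset_range_val _ (norm_ne_zero_iff.mp h))

lemma tsum_twistedTerm_one :
    ∑' I : Ideal (𝓞 K), twistedTerm 1 (1 : MulChar (ZMod 1) ℂ) 0 s I =
      ((∑' I : (Ideal (𝓞 K))⁰, (Ideal.absNorm (I : Ideal (𝓞 K)) : ℝ) ^ (-s) : ℝ) : ℂ) := by
  rw [← Subtype.val_injective.tsum_eq (support_subset_range_val _), Complex.ofReal_tsum]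
  exact tsum_congr fun I => twistedTerm_one_apply I

lemma tsum_twistedTerm_zero : ∑' I : Ideal (𝓞 K), twistedTerm χ ψ 0 s I =
    ∑' I : (Ideal (𝓞 K))⁰, (χ (ClassGroup.mk0 I) : ℂ) *
      (((Ideal.absNorm (I : Ideal (𝓞 K)) : ℝ) ^ (-s) : ℝ) : ℂ) := by
  rw [← Subtype.val_injective.tsum_eq (support_subset_range_val _)]
  exact tsum_congr fun I => by rw [twistedTerm_apply, idealChar_apply, pow_zero, mul_one]

lemma summable_classTerm {J : Ideal (𝓞 K)} (hs : 1 < s) :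
    Summable fun I => classTerm J ψ s I := by
  refine Summable.of_norm_bounded (summable_norm_twistedTerm 1 (1 : MulChar (ZMod 1) ℂ) (j := 0) hs)
    fun I => ?_
  rw [classTerm]
  split_ifs with h
  · rw [show I = ((⟨I, mem_nonZeroDivisors_of_ne_zero h.1⟩ : (Ideal (𝓞 K))⁰) : Ideal (𝓞 K)) from rfl,
      twistedTerm_one_apply, norm_mul]
    exact mul_le_of_le_one_left (norm_nonneg _) (DirichletCharacter.norm_le_one ψ _)
  · rw [norm_zero]
    exact norm_nonneg _

lemma exists_bound_tsum_twistedTerm [IsTotallyReal K] (hK : finrank ℚ K = 2) [NeZero q]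
    (hψ1 : ψ (-1) = 1) (hj : j ≠ 0) {a : (ZMod q)ˣ} (ha : (ψ a ^ j) ^ 2 ≠ 1) :
    ∃ C, ∀ s : ℝ, 1 < s → s ≤ 2 → ‖∑' I, twistedTerm χ ψ j s I‖ ≤ C := by
  classical
  have hpow : ∀ x : ZMod q, (ψ ^ j) x = ψ x ^ j := fun x => MulChar.pow_apply' ψ hj x
  choose J hJ using fun C : ClassGroup (𝓞 K) => ClassGroup.mk0_surjective C⁻¹
  choose B hB using fun C => exists_bound_tsum_classTerm hK (ψ ^ j)
    (by rw [hpow, hψ1, one_pow]) (a := a) (by rwa [hpow]) (nonZeroDivisors.coe_ne_zero (J C))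
  refine ⟨∑ C, B C, fun s hs hs2 => ?_⟩
  have hterm : ∀ I, twistedTerm χ ψ j s I =
      ∑ C, (χ C : ℂ) * classTerm (J C : Ideal (𝓞 K)) (ψ ^ j) s I := fun I => by
    rcases eq_or_ne I ⊥ with rfl | hI
    · rw [show (⊥ : Ideal (𝓞 K)) = 0 from rfl, map_zero]
      exact (Finset.sum_eq_zero fun C _ => by simp [classTerm]).symm
    set I' : (Ideal (𝓞 K))⁰ := ⟨I, mem_nonZeroDivisors_of_ne_zero hI⟩ with hI'
    have hiff : ∀ C, (∃ α, I * (J C : Ideal (𝓞 K)) = Ideal.span {α}) ↔ ClassGroup.mk0 I' = C := fun C => by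
      rw [← mul_inv_eq_one, ← hJ C, ← map_mul, ClassGroup.mk0_eq_one_iff,
        Submodule.isPrincipal_iff]
      rfl
    rw [Finset.sum_eq_single_of_mem (ClassGroup.mk0 I') (Finset.mem_univ _) fun C _ hC => ?_]
    · rw [classTerm, if_pos ⟨hI, (hiff _).mpr rfl⟩, twistedTerm_apply,
        show I = (I' : Ideal (𝓞 K)) from rfl, idealChar_apply, hpow, mul_assoc]
    · rw [classTerm, if_neg fun h => hC ((hiff C).mp h.2).symm, mul_zero]
  simp_rw [hterm]
  rw [Summable.tsum_finsetSum fun C _ => (summable_classTerm _ hs).mul_left _]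
  refine (norm_sum_le _ _).trans (Finset.sum_le_sum fun C _ => ?_)
  rw [tsum_mul_left, norm_mul, norm_character_eq_one, one_mul]
  exact hB C s hs hs2

end TwistedTerm

section NormSurjective

open Filter Topology IsDedekindDomain

variable {K L F : Type*} [Field K] [NumberField K] [Field L] [NumberField L] [Field F]
  [NumberField F] [Algebra K L] [Algebra L F] [Algebra K F] [IsScalarTower K L F] [IsGalois K F]
  {ζ : 𝓞 F} {q : ℕ} {ψ : MulChar (ZMod q) ℂ} {ℓ : ℕ}

omit [NumberField K] in
lemma exists_finset_primesOver (v : HeightOneSpectrum (𝓞 K)) [v.asIdeal.IsMaximal] :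
    ∃ T : Finset (HeightOneSpectrum (𝓞 L)),
      (∀ w, w ∈ T ↔ w.asIdeal.under (𝓞 K) = v.asIdeal) ∧
      ∀ f : Ideal (𝓞 L) → ℝ, ∏ w ∈ T, f w.asIdeal = ∏ P : v.asIdeal.primesOver (𝓞 L), f P.1 := by
  let e : v.asIdeal.primesOver (𝓞 L) ↪ HeightOneSpectrum (𝓞 L) :=
    ⟨fun P => ⟨P.1, P.2.1, Ideal.ne_bot_of_mem_primesOver v.ne_bot P.2⟩, fun P Q h =>
      Subtype.ext (congrArg HeightOneSpectrum.asIdeal h)⟩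
  refine ⟨Finset.univ.map e, fun w => ?_, fun f => by rw [Finset.prod_map]; rfl⟩
  simp only [Finset.mem_map, Finset.mem_univ, true_and]
  constructor
  · rintro ⟨P, rfl⟩
    exact P.2.2.over.symm
  · intro h
    exact ⟨⟨w.asIdeal, w.isPrime, ⟨h.symm⟩⟩, rfl⟩

theorem tsum_absNorm_le_prod_tsum_twistedTerm (hq' : q.Prime) (hℓ : ℓ.Prime)
    (hL : finrank K L = ℓ) (hζ : ζ ^ q = 1)
    (hψ : ∀ (σ : Gal(F/K)) (a : ℕ), σ • ζ = ζ ^ a →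
      (ψ a = 1 ↔ ∀ x : 𝓞 L, σ • algebraMap (𝓞 L) (𝓞 F) x = algebraMap (𝓞 L) (𝓞 F) x))
    (hψℓ : ψ ^ ℓ = 1) {χ : ClassGroup (𝓞 K) →* ℂˣ}
    (hχ : ∀ P : Ideal (𝓞 L), P ≠ ⊥ → idealChar χ (Ideal.relNorm (𝓞 K) P) = 1) :
    ∃ C : ℝ, ∀ s : ℝ, 1 < s →
      ∑' I : (Ideal (𝓞 L))⁰, (Ideal.absNorm (I : Ideal (𝓞 L)) : ℝ) ^ (-s) ≤
        C * ∏ j ∈ Finset.range ℓ, ‖∑' I, twistedTerm χ ψ j s I‖ := by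
  classical
  have hfin : {v : HeightOneSpectrum (𝓞 K) | (q : 𝓞 K) ∈ v.asIdeal}.Finite := by
    refine (Ideal.finite_factors (I := Ideal.span {(q : 𝓞 K)}) ?_).subset fun v hv => ?_
    · simpa using hq'.ne_zero
    · exact Ideal.dvd_iff_le.mpr ((Ideal.span_singleton_le_iff_mem _).mpr hv)
  set Q := hfin.toFinset with hQ
  refine ⟨(2 ^ (ℓ + 1)) ^ Q.card, fun s hs => ?_⟩
  set Z := ∑' I : (Ideal (𝓞 L))⁰, (Ideal.absNorm (I : Ideal (𝓞 L)) : ℝ) ^ (-s) with hZ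
  set M := ∏ j ∈ Finset.range ℓ, ‖∑' I, twistedTerm χ ψ j s I‖ with hM
  have hZ0 : 0 ≤ Z := tsum_nonneg fun I => Real.rpow_nonneg (Nat.cast_nonneg _) _
  have hM0 : 0 ≤ M := Finset.prod_nonneg fun _ _ => norm_nonneg _
  have hmax : ∀ v : HeightOneSpectrum (𝓞 K), v.asIdeal.IsMaximal := fun v => v.isMaximal
  choose T hT hTprod using fun v : HeightOneSpectrum (𝓞 K) => exists_finset_primesOver (L := L) v
  have hTtend : Tendsto (fun S : Finset (HeightOneSpectrum (𝓞 K)) => S.biUnion T) atTop atTop := by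
    refine tendsto_atTop_finset_of_monotone (fun S S' h => Finset.biUnion_subset_biUnion_of_subset_left T h)
      fun w => ?_
    exact ⟨{⟨w.asIdeal.under (𝓞 K), inferInstance, w.asIdeal.under_ne_bot _ w.ne_bot⟩},
      Finset.mem_biUnion.mpr ⟨_, Finset.mem_singleton_self _, (hT _ w).mpr rfl⟩⟩
  set G := fun S : Finset (HeightOneSpectrum (𝓞 K)) =>
    ∏ w ∈ S.biUnion T, (1 - (Ideal.absNorm w.asIdeal : ℝ) ^ (-s)) with hG
  have hGlim : Tendsto (fun S => Z * G S) atTop (𝓝 1) := by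
    rw [← tendsto_ofReal_iff]
    refine ((tendsto_tsum_mul_prod_one_sub (summable_norm_twistedTerm 1 (1 : MulChar (ZMod 1) ℂ)
      (j := 0) hs)).comp hTtend).congr fun S => ?_
    rw [Function.comp_apply, tsum_twistedTerm_one, hG]
    rw [Complex.ofReal_mul, Complex.ofReal_prod]
    refine congrArg₂ _ rfl (Finset.prod_congr rfl fun w _ => ?_)
    rw [Complex.ofReal_sub, Complex.ofReal_one]
    have := twistedTerm_one_apply (s := s) ⟨w.asIdeal, mem_nonZeroDivisors_of_ne_zero w.ne_bot⟩
    rw [this]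
  have hBlim : Tendsto (fun S : Finset (HeightOneSpectrum (𝓞 K)) => M * ∏ v ∈ S, ‖∏ j ∈ Finset.range ℓ,
      (1 - twistedTerm χ ψ j s v.asIdeal)‖) atTop (𝓝 1) := by
    have h := tendsto_finsetProd (Finset.range ℓ) fun j _ =>
      (tendsto_tsum_mul_prod_one_sub (summable_norm_twistedTerm χ ψ (j := j) hs)).norm
    simp only [norm_one, Finset.prod_const_one] at h
    refine h.congr fun S => ?_
    simp_rw [norm_mul, norm_prod]
    rw [Finset.prod_mul_distrib, Finset.prod_comm]
  have hle : ∀ S, ∏ v ∈ S, ‖∏ j ∈ Finset.range ℓ, (1 - twistedTerm χ ψ j s v.asIdeal)‖ ≤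
      (2 ^ (ℓ + 1)) ^ Q.card * G S := fun S => by
    have hdisj : (S : Set (HeightOneSpectrum (𝓞 K))).PairwiseDisjoint T := fun v _ v' _ hne =>
      Finset.disjoint_left.mpr fun w hw hw' =>
        hne (HeightOneSpectrum.ext (((hT v w).mp hw).symm.trans ((hT v' w).mp hw')))
    have hnn : ∀ v : HeightOneSpectrum (𝓞 K),
        0 ≤ ∏ w ∈ T v, (1 - (Ideal.absNorm w.asIdeal : ℝ) ^ (-s)) := fun v =>
      Finset.prod_nonneg fun w _ => sub_nonneg.mpr <| Real.rpow_le_one_of_one_le_of_nonpos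
        (by exact_mod_cast one_le_absNorm L ⟨w.asIdeal, mem_nonZeroDivisors_of_ne_zero w.ne_bot⟩)
        (by linarith)
    calc _ ≤ ∏ v ∈ S, ((if v ∈ Q then (2 : ℝ) ^ (ℓ + 1) else 1) *
          ∏ w ∈ T v, (1 - (Ideal.absNorm w.asIdeal : ℝ) ^ (-s))) := by
          refine Finset.prod_le_prod (fun _ _ => norm_nonneg _) fun v _ => ?_
          rw [hTprod v fun P => 1 - (Ideal.absNorm P : ℝ) ^ (-s)]
          simp only [twistedTerm_apply]
          split_ifs with hv
          · exact norm_prod_one_sub_le_of_mem hq' hℓ.pos hL ψ v.asIdeal v.ne_bot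
              (norm_idealChar_le χ _) (hfin.mem_toFinset.mp hv) hs.le
          · rw [one_mul]
            exact norm_prod_one_sub_le hℓ hL hζ hψ hψℓ hχ v.asIdeal v.ne_bot
              (fun h => hv (hfin.mem_toFinset.mpr h)) (by linarith)
      _ ≤ _ := by
          rw [Finset.prod_mul_distrib, hG]
          simp only
          rw [Finset.prod_biUnion hdisj]
          refine mul_le_mul_of_nonneg_right ?_ (Finset.prod_nonneg fun v _ => hnn v)
          rw [← Finset.prod_filter, Finset.prod_const]
          refine pow_le_pow_right₀ (one_le_pow₀ one_le_two) (Finset.card_le_card fun v hv => ?_)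
          exact (Finset.mem_filter.mp hv).2
  have h1 : Tendsto (fun S : Finset (HeightOneSpectrum (𝓞 K)) => Z * (M * ∏ v ∈ S, ‖∏ j ∈ Finset.range ℓ,
      (1 - twistedTerm χ ψ j s v.asIdeal)‖)) atTop (𝓝 (Z * 1)) := hBlim.const_mul Z
  have h2 : Tendsto (fun S => (2 ^ (ℓ + 1)) ^ Q.card * M * (Z * G S)) atTop
    (𝓝 ((2 ^ (ℓ + 1)) ^ Q.card * M * 1)) := hGlim.const_mul _
  have h3 := le_of_tendsto_of_tendsto' h1 h2 fun S => by
    calc Z * (M * _) ≤ Z * (M * ((2 ^ (ℓ + 1)) ^ Q.card * G S)) := by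
          gcongr
          exact hle S
      _ = _ := by ring
  simpa using h3

theorem character_eq_one_of_relNorm [IsTotallyReal K] (hK : finrank ℚ K = 2) (hq' : q.Prime)
    (hℓ : ℓ.Prime) (hL : finrank K L = ℓ) (hζ : ζ ^ q = 1)
    (hψ : ∀ (σ : Gal(F/K)) (a : ℕ), σ • ζ = ζ ^ a →
      (ψ a = 1 ↔ ∀ x : 𝓞 L, σ • algebraMap (𝓞 L) (𝓞 F) x = algebraMap (𝓞 L) (𝓞 F) x))
    (hψℓ : ψ ^ ℓ = 1) (hψ1 : ψ (-1) = 1)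
    (hψ2 : ∀ j, j ≠ 0 → j < ℓ → ∃ a : (ZMod q)ˣ, (ψ a ^ j) ^ 2 ≠ 1)
    {χ : ClassGroup (𝓞 K) →* ℂˣ}
    (hχ : ∀ P : Ideal (𝓞 L), P ≠ ⊥ → idealChar χ (Ideal.relNorm (𝓞 K) P) = 1) : χ = 1 := by
  by_contra hne
  have : NeZero q := ⟨hq'.ne_zero⟩
  obtain ⟨C, hC⟩ := tsum_absNorm_le_prod_tsum_twistedTerm hq' hℓ hL hζ hψ hψℓ hχ
  obtain ⟨l, hl, hlim⟩ := tendsto_sub_one_mul_tsum_absNorm_rpow L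
  have hB : ∀ j, ∃ B : ℝ, j ≠ 0 → j < ℓ → ∀ s : ℝ, 1 < s → s ≤ 2 →
      ‖∑' I, twistedTerm χ ψ j s I‖ ≤ B := fun j => by
    by_cases hj : j ≠ 0 ∧ j < ℓ
    · obtain ⟨a, ha⟩ := hψ2 j hj.1 hj.2
      obtain ⟨B, hB⟩ := exists_bound_tsum_twistedTerm χ ψ hK hψ1 hj.1 ha
      exact ⟨B, fun _ _ => hB⟩
    · exact ⟨0, fun h1 h2 => (hj ⟨h1, h2⟩).elim⟩
  choose B hB using hB
  have h0 : Tendsto (fun s : ℝ => |C| * (‖((s - 1 : ℝ) : ℂ) * ∑' I, twistedTerm χ ψ 0 s I‖ *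
      ∏ j ∈ (Finset.range ℓ).erase 0, B j)) (𝓝[>] 1) (𝓝 0) := by
    have h := (tendsto_sub_one_mul_tsum_character K χ hne).norm
    simp_rw [← tsum_twistedTerm_zero χ ψ] at h
    simpa using (h.mul_const (∏ j ∈ (Finset.range ℓ).erase 0, B j)).const_mul |C|
  refine hl.not_ge (le_of_tendsto_of_tendsto hlim h0 ?_)
  filter_upwards [Ioc_mem_nhdsGT (show (1 : ℝ) < 2 by norm_num)] with s hs
  have hs0 : 0 ≤ s - 1 := by linarith [hs.1]
  calc _ ≤ (s - 1) * (C * ∏ j ∈ Finset.range ℓ, ‖∑' I, twistedTerm χ ψ j s I‖) := by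
        gcongr
        exact hC s hs.1
    _ ≤ (s - 1) * (|C| * ∏ j ∈ Finset.range ℓ, ‖∑' I, twistedTerm χ ψ j s I‖) := by
        gcongr
        exact le_abs_self C
    _ = |C| * (‖((s - 1 : ℝ) : ℂ) * ∑' I, twistedTerm χ ψ 0 s I‖ *
          ∏ j ∈ (Finset.range ℓ).erase 0, ‖∑' I, twistedTerm χ ψ j s I‖) := by
        rw [← Finset.mul_prod_erase _ _ (Finset.mem_range.mpr hℓ.pos), norm_mul,
          Complex.norm_real, Real.norm_of_nonneg hs0]
        ring
    _ ≤ _ := by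
        gcongr with j hj
        have hj' := Finset.mem_erase.mp hj
        exact hB j hj'.1 (Finset.mem_range.mp hj'.2) s hs.1 hs.2

end NormSurjective

section GroupTheory

variable {G B : Type*} [CommGroup G] [CommGroup B] {p : ℕ} (hp : p.Prime)

lemma mem_pPart_iff {g : G} : g ∈ pPart G p hp ↔ ∃ n : ℕ, g ^ p ^ n = 1 := Iff.rfl

lemma mem_pPart_of_pow_eq_one {g : G} (hg : g ^ p = 1) : g ∈ pPart G p hp :=
  (mem_pPart_iff hp).mpr ⟨1, by rwa [pow_one]⟩

include hp in
lemma exists_pow_pow_eq_self {b : B} {c n : ℕ} (hc : ¬ p ∣ c) (hb : b ^ p ^ n = 1) :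
    ∃ e : ℕ, (b ^ c) ^ e = b :=
  exists_pow_eq_self_of_coprime <| Nat.Coprime.coprime_dvd_right (orderOf_dvd_of_pow_eq_one hb)
    (((Nat.Prime.coprime_iff_not_dvd hp).mpr hc).symm.pow_right n)

/-- The restriction of a homomorphism to the `p`-parts. -/
def pPartMap (f : G →* B) : pPart G p hp →* pPart B p hp :=
  (f.comp (pPart G p hp).subtype).codRestrict _ fun g => by
    obtain ⟨n, hn⟩ := (mem_pPart_iff hp).mp g.2
    exact (mem_pPart_iff hp).mpr ⟨n, by simp [← map_pow, hn]⟩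

lemma coe_pPartMap (f : G →* B) (g : pPart G p hp) : (pPartMap hp f g : B) = f g := rfl

lemma card_ker_mul_card_range {G B : Type*} [Group G] [Group B] (f : G →* B) :
    Nat.card f.ker * Nat.card f.range = Nat.card G := by
  rw [← Nat.card_congr (QuotientGroup.quotientKerEquivRange f).toEquiv, mul_comm,
    ← Subgroup.card_eq_card_quotient_mul_card_subgroup]

lemma pRank_eq_factorization_card_ker [Finite G] :
    pRank G p hp = (Nat.card (powMonoidHom p : G →* G).ker).factorization p := by
  have h1 := card_ker_mul_card_range (powMonoidHom p : pPart G p hp →* pPart G p hp)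
  have h2 := Subgroup.card_eq_card_quotient_mul_card_subgroup
    (powMonoidHom p : pPart G p hp →* pPart G p hp).range
  have e : (powMonoidHom p : pPart G p hp →* pPart G p hp).ker ≃ (powMonoidHom p : G →* G).ker :=
    { toFun := fun g => ⟨g.1.1, congrArg Subtype.val (MonoidHom.mem_ker.mp g.2)⟩
      invFun := fun g => ⟨⟨g.1, mem_pPart_of_pow_eq_one hp g.2⟩, Subtype.ext g.2⟩ }
  rw [pRank, Nat.mul_right_cancel Nat.card_pos (h2.symm.trans h1.symm), Nat.card_congr e]

/-- The restriction of a homomorphism to the elements of order dividing `p`. -/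
def powKerMap (p : ℕ) (f : G →* B) :
    (powMonoidHom p : G →* G).ker →* (powMonoidHom p : B →* B).ker :=
  (f.comp (powMonoidHom p : G →* G).ker.subtype).codRestrict _ fun g => by
    have : (g : G) ^ p = 1 := g.2
    simp [MonoidHom.mem_ker, ← map_pow, this]

theorem pRank_eq_of_surjective [Finite G] [Finite B] {f : G →* B} (hf : Function.Surjective f)
    (hcard : pCard G p hp = pCard B p hp) : pRank G p hp = pRank B p hp := by
  have hsurj : Function.Surjective (pPartMap hp f) := fun b => by
    obtain ⟨n, hn⟩ := (mem_pPart_iff hp).mp b.2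
    obtain ⟨g, hg⟩ := hf b
    obtain ⟨a, c, hc, hGc⟩ :=
      Nat.exists_eq_pow_mul_and_not_dvd (Nat.card_pos (α := G)).ne' p hp.ne_one
    obtain ⟨e, he⟩ := exists_pow_pow_eq_self hp hc hn
    refine ⟨⟨(g ^ c) ^ e, (mem_pPart_iff hp).mpr ⟨a, ?_⟩⟩, Subtype.ext ?_⟩
    · rw [pow_right_comm, ← pow_mul g, mul_comm c, ← hGc, pow_card_eq_one', one_pow]
    · rw [coe_pPartMap, map_pow, map_pow, hg, he]
  have hinj : Function.Injective (pPartMap hp f) :=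
    ((Nat.bijective_iff_surjective_and_card _).mpr ⟨hsurj, hcard⟩).1
  rw [pRank_eq_factorization_card_ker, pRank_eq_factorization_card_ker,
    Nat.card_eq_of_bijective (powKerMap p f) ⟨fun g g' h => ?_, fun b => ?_⟩]
  · have := @hinj ⟨g, mem_pPart_of_pow_eq_one hp g.2⟩ ⟨g', mem_pPart_of_pow_eq_one hp g'.2⟩
      (Subtype.ext (congrArg Subtype.val h :))
    exact Subtype.ext (congrArg Subtype.val this :)
  · obtain ⟨g, hg⟩ := hsurj ⟨b, mem_pPart_of_pow_eq_one hp b.2⟩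
    have hgp : g ^ p = 1 := hinj <| Subtype.ext <| by
      rw [map_pow, hg, map_one]
      exact b.2
    exact ⟨⟨g, congrArg Subtype.val hgp⟩, Subtype.ext (congrArg Subtype.val hg :)⟩

theorem pRank_eq_one_add [Finite G] [Finite B] {f : G →* B} {i : B →* G} {d : ℕ}
    (hfi : ∀ b, f (i b) = b ^ d) (hd : ¬ p ∣ d) (hcard : pCard G p hp = p * pCard B p hp) :
    pRank G p hp = 1 + pRank B p hp := by
  have hlift : ∀ (b : B) (n : ℕ), b ^ p ^ n = 1 → ∃ g, g ^ p ^ n = 1 ∧ f g = b := fun b n hb => by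
    obtain ⟨e, he⟩ := exists_pow_pow_eq_self hp hd hb
    exact ⟨i b ^ e, by rw [pow_right_comm, ← map_pow, hb, map_one, one_pow],
      by rw [map_pow, hfi, he]⟩
  have hsurj : Function.Surjective (pPartMap hp f) := fun b => by
    obtain ⟨n, hn⟩ := (mem_pPart_iff hp).mp b.2
    obtain ⟨g, hg, hgb⟩ := hlift b n hn
    exact ⟨⟨g, (mem_pPart_iff hp).mpr ⟨n, hg⟩⟩, Subtype.ext hgb⟩
  have hker : Nat.card (pPartMap hp f).ker = p := by
    have h := card_ker_mul_card_range (pPartMap hp f)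
    rw [MonoidHom.range_eq_top.mpr hsurj, Subgroup.card_top] at h
    exact Nat.mul_right_cancel Nat.card_pos (h.trans hcard)
  have hsurj' : Function.Surjective (powKerMap p f) := fun b => by
    obtain ⟨g, hg, hgb⟩ := hlift b 1 (by rw [pow_one]; exact b.2)
    exact ⟨⟨g, by rwa [pow_one] at hg⟩, Subtype.ext hgb⟩
  have e : (powKerMap p f).ker ≃ (pPartMap hp f).ker :=
    { toFun := fun g => ⟨⟨g.1, mem_pPart_of_pow_eq_one hp g.1.2⟩,
        Subtype.ext (congrArg Subtype.val (MonoidHom.mem_ker.mp g.2) :)⟩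
      invFun := fun g => ⟨⟨g.1, by
          have h := pow_card_eq_one' (x := g)
          rw [hker] at h
          exact congrArg (fun x => x.1.1) h⟩,
        Subtype.ext (congrArg Subtype.val (MonoidHom.mem_ker.mp g.2) :)⟩ }
  have h := card_ker_mul_card_range (powKerMap p f)
  rw [MonoidHom.range_eq_top.mpr hsurj', Subgroup.card_top, Nat.card_congr e, hker] at h
  rw [pRank_eq_factorization_card_ker, pRank_eq_factorization_card_ker, ← h,
    Nat.factorization_mul hp.ne_zero Nat.card_pos.ne', Finsupp.add_apply, hp.factorization_self]

end GroupTheory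

section ClassNorm

variable (K L : Type*) [Field K] [NumberField K] [Field L] [NumberField L] [Algebra K L]

lemma relNorm_mem_nonZeroDivisors (I : (Ideal (𝓞 L))⁰) :
    Ideal.relNorm (𝓞 K) (I : Ideal (𝓞 L)) ∈ (Ideal (𝓞 K))⁰ :=
  mem_nonZeroDivisors_of_ne_zero (Ideal.relNorm_eq_bot_iff.not.mpr (nonZeroDivisors.coe_ne_zero I))

lemma mk0_relNorm_eq_of_mk0_eq {I J : (Ideal (𝓞 L))⁰} (h : ClassGroup.mk0 I = ClassGroup.mk0 J) :
    ClassGroup.mk0 ⟨_, relNorm_mem_nonZeroDivisors K L I⟩ =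
      ClassGroup.mk0 ⟨_, relNorm_mem_nonZeroDivisors K L J⟩ := by
  obtain ⟨x, y, hx, hy, hxy⟩ := ClassGroup.mk0_eq_mk0_iff.mp h
  refine ClassGroup.mk0_eq_mk0_iff.mpr ⟨Algebra.intNorm (𝓞 K) (𝓞 L) x,
    Algebra.intNorm (𝓞 K) (𝓞 L) y, Algebra.intNorm_ne_zero.mpr hx, Algebra.intNorm_ne_zero.mpr hy, ?_⟩
  rw [← Ideal.relNorm_singleton, ← Ideal.relNorm_singleton, ← map_mul, hxy, map_mul]

/-- The homomorphism of class groups induced by the relative norm of ideals. -/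
def classNorm : ClassGroup (𝓞 L) →* ClassGroup (𝓞 K) :=
  MonoidHom.mk' (fun C => ClassGroup.mk0
    ⟨_, relNorm_mem_nonZeroDivisors K L (ClassGroup.mk0_surjective C).choose⟩) fun C D => by
      have h : ∀ C : ClassGroup (𝓞 L), ClassGroup.mk0 (ClassGroup.mk0_surjective C).choose = C :=
        fun C => (ClassGroup.mk0_surjective C).choose_spec
      refine (mk0_relNorm_eq_of_mk0_eq K L (J := (ClassGroup.mk0_surjective C).choose *
        (ClassGroup.mk0_surjective D).choose) (by rw [map_mul, h, h, h])).trans ?_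
      rw [← map_mul]
      exact congrArg _ (Subtype.ext (map_mul (Ideal.relNorm (𝓞 K)) _ _))

lemma classNorm_mk0 (I : (Ideal (𝓞 L))⁰) : classNorm K L (ClassGroup.mk0 I) =
    ClassGroup.mk0 ⟨_, relNorm_mem_nonZeroDivisors K L I⟩ :=
  mk0_relNorm_eq_of_mk0_eq K L (ClassGroup.mk0_surjective (ClassGroup.mk0 I)).choose_spec

lemma classNorm_extendedHom (C : ClassGroup (𝓞 K)) :
    classNorm K L (ClassGroup.extendedHom (𝓞 K) (𝓞 L) C) = C ^ finrank K L := by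
  obtain ⟨I, rfl⟩ := ClassGroup.mk0_surjective C
  rw [ClassGroup.extendedHom_mk0, classNorm_mk0, ← map_pow]
  congr 1
  refine Subtype.ext ?_
  rw [IsFractionRing.finrank_eq (𝓞 K) K (𝓞 L) L]
  exact Ideal.relNorm_algebraMap _ _

theorem classNorm_surjective (h : ∀ χ : ClassGroup (𝓞 K) →* ℂˣ,
    (∀ P : Ideal (𝓞 L), P ≠ ⊥ → idealChar χ (Ideal.relNorm (𝓞 K) P) = 1) → χ = 1) :
    Function.Surjective (classNorm K L) := by
  rw [← MonoidHom.range_eq_top]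
  by_contra hne
  obtain ⟨C, hC⟩ := SetLike.exists_not_mem_of_ne_top _ hne
  obtain ⟨φ, hφ⟩ := CommGroup.exists_apply_ne_one_of_hasEnoughRootsOfUnity
    (ClassGroup (𝓞 K) ⧸ (classNorm K L).range) ℂ
    (a := QuotientGroup.mk C) ((QuotientGroup.eq_one_iff C).not.mpr hC)
  refine hφ (DFunLike.congr_fun (h (φ.comp (QuotientGroup.mk' _)) fun P hP => ?_) C)
  have := idealChar_apply (φ.comp (QuotientGroup.mk' (classNorm K L).range))
    ⟨_, relNorm_mem_nonZeroDivisors K L ⟨P, mem_nonZeroDivisors_of_ne_zero hP⟩⟩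
  rw [← classNorm_mk0] at this
  rw [this, MonoidHom.comp_apply, QuotientGroup.mk'_apply,
    (QuotientGroup.eq_one_iff _).mpr (MonoidHom.mem_range.mpr ⟨_, rfl⟩), map_one, Units.val_one]

end ClassNorm

section CharacterOfSubfield

variable {G : Type*} [CommGroup G] [Finite G] {ℓ : ℕ}

lemma exists_character_ker_eq (hℓ : ℓ.Prime) {H : Subgroup G} (hH : H.index = ℓ) :
    ∃ φ : G →* ℂˣ, φ.ker = H ∧ φ ^ ℓ = 1 := by
  have hcard : Nat.card (G ⧸ H) = ℓ := hH
  have : Fact (Nat.card (G ⧸ H)).Prime := ⟨hcard ▸ hℓ⟩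
  have : Nontrivial (G ⧸ H) := Finite.one_lt_card_iff_nontrivial.mp (hcard ▸ hℓ.one_lt)
  obtain ⟨a, ha⟩ := exists_ne (1 : G ⧸ H)
  obtain ⟨φ, hφ⟩ := CommGroup.exists_apply_ne_one_of_hasEnoughRootsOfUnity (G ⧸ H) ℂ ha
  have hker : φ.ker = ⊥ := (Subgroup.eq_bot_or_eq_top_of_prime_card φ.ker).resolve_right fun h =>
    hφ (MonoidHom.mem_ker.mp (h ▸ Subgroup.mem_top a))
  refine ⟨φ.comp (QuotientGroup.mk' H), ?_, ?_⟩
  · rw [← MonoidHom.comap_ker, hker, MonoidHom.comap_bot, QuotientGroup.ker_mk']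
  · ext g
    have : (QuotientGroup.mk' H g) ^ ℓ = 1 := by rw [← hcard, pow_card_eq_one']
    rw [MonoidHom.pow_apply, MonoidHom.comp_apply, ← map_pow, this, map_one, MonoidHom.one_apply]

variable {n q : ℕ} [NeZero n] [NeZero q] {F : Type*} [Field F] [NumberField F]
  [IsCyclotomicExtension {n} ℚ F] {ζ : F}

lemma apply_primitiveRoot_eq_pow_iff (h : q ∣ n) (hζ : IsPrimitiveRoot ζ q) (σ : Gal(F/ℚ)) (a : ℕ) :
    σ ζ = ζ ^ a ↔
      ((ZMod.unitsMap h (IsCyclotomicExtension.Rat.galEquivZMod n F σ) : (ZMod q)ˣ) : ZMod q) = a := by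
  rw [IsCyclotomicExtension.Rat.galEquivZMod_apply_of_pow_eq n F σ
    ((hζ.pow_eq_one_iff_dvd _).mpr h), (hζ.isOfFinOrder (NeZero.ne _)).pow_inj_mod,
    ← hζ.eq_orderOf, ← ZMod.natCast_eq_natCast_iff', ZMod.natCast_val, ZMod.unitsMap_val]

omit [NumberField F] in
lemma mem_fixedField_zpowers [CharZero F] {σ : Gal(F/ℚ)} {x : F} (h : σ x = x) :
    x ∈ IntermediateField.fixedField (Subgroup.zpowers σ) := by
  rintro ⟨_, k, rfl⟩
  exact MulAction.mem_stabilizer_iff.mp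
    (Subgroup.zpow_mem (MulAction.stabilizer Gal(F/ℚ) x) h k)

theorem exists_mulChar_of_subfield (h : q ∣ n) (hζ : IsPrimitiveRoot ζ q) (hℓ : ℓ.Prime)
    (hodd : Odd ℓ) {M : IntermediateField ℚ F} (hM : M ≤ ℚ⟮ζ⟯) (hMℓ : finrank ℚ M = ℓ) :
    ∃ ψ : MulChar (ZMod q) ℂ, ψ ^ ℓ = 1 ∧ ψ (-1) = 1 ∧
      (∀ j, j ≠ 0 → j < ℓ → ∃ a : (ZMod q)ˣ, (ψ a ^ j) ^ 2 ≠ 1) ∧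
      ∀ (σ : Gal(F/ℚ)) (a : ℕ), σ ζ = ζ ^ a → (ψ a = 1 ↔ ∀ x ∈ M, σ x = x) := by
  have : IsGalois ℚ F := IsCyclotomicExtension.isGalois {n} ℚ F
  set g : Gal(F/ℚ) →* (ZMod q)ˣ :=
    (ZMod.unitsMap h).comp (IsCyclotomicExtension.Rat.galEquivZMod n F).toMonoidHom with hg
  have hgsurj : Function.Surjective g :=
    (ZMod.unitsMap_surjective h).comp (IsCyclotomicExtension.Rat.galEquivZMod n F).surjective
  have hgspec : ∀ (σ : Gal(F/ℚ)) (a : ℕ), σ ζ = ζ ^ a ↔ (g σ : ZMod q) = a :=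
    apply_primitiveRoot_eq_pow_iff h hζ
  have hker : g.ker ≤ M.fixingSubgroup := fun σ hσ => by
    have h1 : σ ζ = ζ := by
      simpa using (hgspec σ 1).mpr (by rw [MonoidHom.mem_ker.mp hσ, Units.val_one, Nat.cast_one])
    have h2 : ℚ⟮ζ⟯ ≤ IntermediateField.fixedField (Subgroup.zpowers σ) := by
      rw [IntermediateField.adjoin_simple_le_iff]
      exact mem_fixedField_zpowers h1
    exact (IntermediateField.mem_fixingSubgroup_iff _ _).mpr fun x hx =>
      h2 (hM hx) ⟨σ, Subgroup.mem_zpowers σ⟩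
  have hidx : (M.fixingSubgroup.map g).index = ℓ := by
    rw [Subgroup.index_map_eq _ hgsurj hker, ← IntermediateField.finrank_eq_fixingSubgroup_index,
      hMℓ]
  obtain ⟨φ, hφker, hφℓ⟩ := exists_character_ker_eq hℓ hidx
  have hval : ∀ u : (ZMod q)ˣ, MulChar.ofUnitHom φ u = φ u := MulChar.ofUnitHom_coe φ
  have hpow : ∀ u : (ZMod q)ˣ, φ u ^ ℓ = 1 := fun u => by
    rw [← MonoidHom.pow_apply, hφℓ, MonoidHom.one_apply]
  have hco : ∀ j, j ≠ 0 → j < ℓ → Nat.Coprime ℓ (j * 2) := fun j hj hjℓ =>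
    Nat.Coprime.mul_right (Nat.coprime_of_lt_prime hj hjℓ hℓ) hodd.coprime_two_right
  have hone : ∀ (u : (ZMod q)ˣ) j, j ≠ 0 → j < ℓ → φ u ^ (j * 2) = 1 → φ u = 1 :=
    fun u j hj hjℓ hu => by
      rw [← pow_one (φ u), ← (hco j hj hjℓ).gcd_eq_one]
      exact pow_gcd_eq_one.mpr ⟨hpow u, hu⟩
  refine ⟨MulChar.ofUnitHom φ, ?_, ?_, fun j hj hjℓ => ?_, fun σ a hσ => ?_⟩
  · ext u
    rw [MulChar.pow_apply_coe, hval, ← Units.val_pow_eq_pow_val, hpow, MulChar.one_apply_coe,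
      Units.val_one]
  · rw [← Units.val_one, ← Units.val_neg, hval, hone (-1) 1 one_ne_zero hℓ.one_lt, Units.val_one]
    rw [← map_pow, one_mul, neg_one_sq, map_one]
  · by_contra! hall
    refine hℓ.one_lt.ne' (hidx.symm.trans ?_)
    rw [← hφker, Subgroup.index_eq_one, eq_top_iff]
    intro u _
    refine hone u j hj hjℓ (Units.ext ?_)
    have := hall u
    rwa [hval, ← pow_mul] at this
  · rw [← (hgspec σ a).mp hσ, hval, Units.val_eq_one, ← MonoidHom.mem_ker, hφker,
      ← Subgroup.mem_comap, Subgroup.comap_map_eq_self hker,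
      IntermediateField.mem_fixingSubgroup_iff]

end CharacterOfSubfield

section CyclotomicClassNorm

variable {n q ℓ : ℕ} [NeZero n] {K L F : Type*} [Field K] [NumberField K] [Field L] [NumberField L]
  [Field F] [NumberField F] [Algebra K L] [Algebra L F] [Algebra K F] [IsScalarTower K L F]
  [IsCyclotomicExtension {n} ℚ F] {ζ : F}

omit [NumberField K] [NumberField F] [Algebra K L] [IsScalarTower K L F] in
lemma forall_ringOfIntegers_smul_iff (σ : Gal(F/K)) :
    (∀ x : 𝓞 L, σ • algebraMap (𝓞 L) (𝓞 F) x = algebraMap (𝓞 L) (𝓞 F) x) ↔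
      ∀ x : L, σ (algebraMap L F x) = algebraMap L F x := by
  have key : ∀ x : 𝓞 L, (σ • algebraMap (𝓞 L) (𝓞 F) x = algebraMap (𝓞 L) (𝓞 F) x) ↔
      σ (algebraMap L F x) = algebraMap L F x := fun x => by
    rw [← RingOfIntegers.coe_injective.eq_iff]
    rfl
  refine ⟨fun h x => ?_, fun h x => (key x).mpr (h x)⟩
  obtain ⟨a, b, hb, rfl⟩ := IsFractionRing.div_surjective (A := 𝓞 L) x
  rw [map_div₀, map_div₀, (key a).mp (h a), (key b).mp (h b)]

theorem classNorm_surjective_of_isCyclotomicExtension [IsTotallyReal K] (hK : finrank ℚ K = 2)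
    (hq : q.Prime) (hqn : q ∣ n) (hζ : IsPrimitiveRoot ζ q) (hℓ : ℓ.Prime) (hodd : Odd ℓ)
    (hL : finrank K L = ℓ) {M : IntermediateField ℚ F} (hM : M ≤ ℚ⟮ζ⟯) (hMℓ : finrank ℚ M = ℓ)
    (hML : (algebraMap L F).toRatAlgHom.fieldRange =
      (algebraMap K F).toRatAlgHom.fieldRange ⊔ M) :
    Function.Surjective (classNorm K L) := by
  have : NeZero q := ⟨hq.ne_zero⟩
  have : IsGalois ℚ F := IsCyclotomicExtension.isGalois {n} ℚ F
  have : IsGalois K F := IsGalois.tower_top_of_isGalois ℚ K F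
  obtain ⟨ψ, hψℓ, hψ1, hψ2, hψ⟩ := exists_mulChar_of_subfield hqn hζ hℓ hodd hM hMℓ
  obtain ⟨z, hz⟩ : ∃ z : 𝓞 F, algebraMap (𝓞 F) F z = ζ := ⟨⟨ζ, hζ.isIntegral hq.pos⟩, rfl⟩
  refine classNorm_surjective K L fun χ hχ => ?_
  refine character_eq_one_of_relNorm (ζ := z) hK hq hℓ hL (RingOfIntegers.coe_injective ?_)
    (fun σ a hσ => ?_) hψℓ hψ1 hψ2 hχ
  · rw [map_pow, map_one, hz, hζ.pow_eq_one]
  · rw [hψ (σ.restrictScalars ℚ) a, forall_ringOfIntegers_smul_iff]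
    · refine ⟨fun h x => ?_, fun h x hx => ?_⟩
      · have hle : (algebraMap L F).toRatAlgHom.fieldRange ≤
            IntermediateField.fixedField (Subgroup.zpowers (σ.restrictScalars ℚ)) := by
          rw [hML, sup_le_iff]
          refine ⟨?_, fun y hy => mem_fixedField_zpowers (h y hy)⟩
          rintro _ ⟨y, rfl⟩
          exact mem_fixedField_zpowers (σ.commutes y)
        exact hle ⟨x, rfl⟩ ⟨_, Subgroup.mem_zpowers _⟩
      · obtain ⟨y, rfl⟩ := (le_sup_right.trans_eq hML.symm : M ≤ _) hx
        exact h y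
    · have := congrArg (algebraMap (𝓞 F) F) hσ
      rw [map_pow, hz] at this
      exact hz ▸ this

end CyclotomicClassNorm

section ComplexSubfields

lemma zetaC_isPrimitiveRoot {n : ℕ} (hn : n ≠ 0) : IsPrimitiveRoot (zetaC n) n :=
  Complex.isPrimitiveRoot_exp n hn

lemma realCyclo_le_adjoin (n : ℕ) : realCyclo n ≤ ℚ⟮zetaC n⟯ := by
  rw [realCyclo, IntermediateField.adjoin_simple_le_iff]
  have h := IntermediateField.mem_adjoin_simple_self ℚ (zetaC n)
  exact add_mem h (inv_mem h)

lemma zetaC_mem_adjoin {q n : ℕ} (hn : n ≠ 0) (h : q ∣ n) : zetaC q ∈ ℚ⟮zetaC n⟯ := by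
  have : NeZero n := ⟨hn⟩
  have hq : q ≠ 0 := ne_zero_of_dvd_ne_zero hn h
  obtain ⟨i, -, hi⟩ := (zetaC_isPrimitiveRoot hn).eq_pow_of_pow_eq_one
    ((zetaC_isPrimitiveRoot hq).pow_eq_one_iff_dvd n |>.mpr h)
  exact hi ▸ pow_mem (IntermediateField.mem_adjoin_simple_self ℚ (zetaC n)) i

lemma realCyclo_le_fieldRange_ofReal (n : ℕ) :
    realCyclo n ≤ (Complex.ofRealAm.restrictScalars ℚ).fieldRange := by
  rw [realCyclo, IntermediateField.adjoin_simple_le_iff]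
  have h : (zetaC n)⁻¹ = starRingEnd ℂ (zetaC n) := by
    rw [zetaC, ← Complex.exp_conj, ← Complex.exp_neg]
    congr 1
    simp [neg_div, Complex.conj_ofNat]
  refine ⟨2 * (zetaC n).re, ?_⟩
  rw [h, Complex.add_conj]
  simp

lemma isTotallyReal_of_finrank_eq_two {n : ℕ} {K : IntermediateField ℚ ℂ} [FiniteDimensional ℚ K]
    (hK : K ≤ realCyclo n) (h : finrank ℚ K = 2) : IsTotallyReal K := by
  have : Algebra.IsQuadraticExtension ℚ K := ⟨h⟩
  have : Normal ℚ K := inferInstance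
  refine ⟨fun v => ?_⟩
  rw [← v.mk_embedding, InfinitePlace.isReal_mk_iff, ComplexEmbedding.isReal_iff]
  set φ := v.embedding
  ext x
  have hx : φ x ∈ K := by
    have hf := @AlgHom.fieldRange_of_normal ℚ ℂ _ _ _ K this { φ with commutes' := map_ratCast φ }
    exact hf.le ⟨x, rfl⟩
  obtain ⟨y, hy⟩ := realCyclo_le_fieldRange_ofReal n (hK hx)
  rw [ComplexEmbedding.conjugate_coe_eq, ← hy]
  exact Complex.conj_ofReal y

lemma finrank_sup_eq_mul {K L : IntermediateField ℚ ℂ} [FiniteDimensional ℚ K]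
    [FiniteDimensional ℚ L] (h : (finrank ℚ K).Coprime (finrank ℚ L)) :
    finrank ℚ ↥(K ⊔ L) = finrank ℚ K * finrank ℚ L := by
  exact (LinearDisjoint.of_finrank_coprime h).finrank_sup

end ComplexSubfields

section ConcreteClassNorm

theorem exists_classGroup_surjective {n q ℓ : ℕ} (hn : 0 < n) (hℓ : ℓ.Prime) (hodd : Odd ℓ)
    (hq : q.Prime) (hqn : q ∣ n) {K M : IntermediateField ℚ ℂ} [FiniteDimensional ℚ K]
    [FiniteDimensional ℚ M] (hK : K ≤ realCyclo n) (hKdeg : finrank ℚ K = 2)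
    (hM : M ≤ realCyclo q) (hMdeg : finrank ℚ M = ℓ) :
    ∃ f : ClassGroup (𝓞 ↥(K ⊔ M)) →* ClassGroup (𝓞 K), Function.Surjective f := by
  have : NeZero n := ⟨hn.ne'⟩
  have : NeZero q := ⟨hq.ne_zero⟩
  have := isTotallyReal_of_finrank_eq_two hK hKdeg
  have hKF : K ≤ ℚ⟮zetaC n⟯ := hK.trans (realCyclo_le_adjoin n)
  have hMq : M ≤ ℚ⟮zetaC q⟯ := hM.trans (realCyclo_le_adjoin q)
  have hζF : zetaC q ∈ ℚ⟮zetaC n⟯ := zetaC_mem_adjoin hn.ne' hqn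
  have hMF : M ≤ ℚ⟮zetaC n⟯ := hMq.trans (IntermediateField.adjoin_simple_le_iff.mpr hζF)
  have hLF : K ⊔ M ≤ ℚ⟮zetaC n⟯ := sup_le hKF hMF
  have hcyc : IsCyclotomicExtension {n} ℚ ℚ⟮zetaC n⟯ := by
    have hz := zetaC_isPrimitiveRoot hn.ne'
    change IsCyclotomicExtension {n} ℚ ℚ⟮zetaC n⟯.toSubalgebra
    rw [IntermediateField.adjoin_simple_toSubalgebra_of_isAlgebraic
      (hz.isIntegral hn).tower_top.isAlgebraic]
    exact hz.adjoin_isCyclotomicExtension ℚ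
  have : NumberField ℚ⟮zetaC n⟯ := IsCyclotomicExtension.numberField {n} ℚ _
  let := (IntermediateField.inclusion (le_sup_left : K ≤ K ⊔ M)).toAlgebra
  let := (IntermediateField.inclusion hLF).toAlgebra
  let := (IntermediateField.inclusion hKF).toAlgebra
  have : IsScalarTower K ↥(K ⊔ M) ℚ⟮zetaC n⟯ := IsScalarTower.of_algebraMap_eq fun _ => rfl
  have hdeg : finrank K ↥(K ⊔ M) = ℓ := by
    have h1 := finrank_mul_finrank ℚ K ↥(K ⊔ M)
    rw [finrank_sup_eq_mul (by rw [hKdeg, hMdeg]; exact hodd.coprime_two_left), hKdeg, hMdeg] at h1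
    exact Nat.eq_of_mul_eq_mul_left two_pos h1
  have hζ : IsPrimitiveRoot (⟨zetaC q, hζF⟩ : ℚ⟮zetaC n⟯) q :=
    IsPrimitiveRoot.coe_submonoidClass_iff.mp (zetaC_isPrimitiveRoot hq.ne_zero)
  refine ⟨classNorm K ↥(K ⊔ M), classNorm_surjective_of_isCyclotomicExtension hKdeg hq hqn hζ hℓ
    hodd hdeg (M := IntermediateField.restrict hMF) ?_ ?_ ?_⟩
  · rintro x hx
    have hx' := hMq ((IntermediateField.mem_restrict hMF x).mp hx)
    have := IntermediateField.lift_adjoin_simple ℚ ℚ⟮zetaC n⟯ ⟨zetaC q, hζF⟩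
    exact (IntermediateField.mem_lift x).mp (this.ge hx')
  · rw [← hMdeg]
    exact (IntermediateField.restrictAlgEquiv hMF).toLinearEquiv.finrank_eq.symm
  · change IntermediateField.restrict hLF =
      IntermediateField.restrict hKF ⊔ IntermediateField.restrict hMF
    refine (IntermediateField.lift_injective ℚ⟮zetaC n⟯) ((IntermediateField.lift_restrict hLF).trans ?_)
    refine Eq.trans ?_ (IntermediateField.lift_sup ℚ ℚ⟮zetaC n⟯ _ _).symm
    rw [IntermediateField.lift_restrict, IntermediateField.lift_restrict]

end ConcreteClassNorm

/-- Case II of the proof of Theorem 1.2, with `ℓ ∤ [H : K_{2ℓ}]`. -/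
theorem statement_13
    (n ℓ q m : ℕ) (hn : 0 < n) (hℓ : ℓ.Prime) (hℓodd : Odd ℓ)
    (hq : q.Prime) (hqn : q ∣ n) (hqℓ : q ≡ 1 [MOD ℓ]) (hm : 1 ≤ m)
    (K₂ Kl : IntermediateField ℚ ℂ) [FiniteDimensional ℚ K₂] [FiniteDimensional ℚ Kl]
    (hK₂H : K₂ ≤ realCyclo n) (hK₂deg : Module.finrank ℚ K₂ = 2)
    (hKl : Kl ≤ realCyclo q) (hKldeg : Module.finrank ℚ Kl = ℓ)
    (hH : pCard (ClassGroup (𝓞 (realCyclo n))) ℓ hℓ = ℓ ^ m)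
    (hK₂cl : pCard (ClassGroup (𝓞 K₂)) ℓ hℓ = ℓ ^ (m - 1))
    (hK₂lcl : pCard (ClassGroup (𝓞 ↥(K₂ ⊔ Kl))) ℓ hℓ = ℓ ^ (m - 1))
    (hsub : K₂ ⊔ Kl ≤ realCyclo n)
    (d : ℕ) (hd : Module.finrank ℚ (realCyclo n) = d * Module.finrank ℚ ↥(K₂ ⊔ Kl))
    (hndvd : ¬ ℓ ∣ d) :
    pRank (ClassGroup (𝓞 (realCyclo n))) ℓ hℓ = 1 + pRank (ClassGroup (𝓞 K₂)) ℓ hℓ := by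
  obtain ⟨f, hf⟩ := exists_classGroup_surjective hn hℓ hℓodd hq hqn hK₂H hK₂deg hKl hKldeg
  rw [← pRank_eq_of_surjective hℓ hf (hK₂lcl.trans hK₂cl.symm)]
  let := (IntermediateField.inclusion hsub).toAlgebra
  have hdeg : finrank ↥(K₂ ⊔ Kl) (realCyclo n) = d := by
    have h := finrank_mul_finrank ℚ ↥(K₂ ⊔ Kl) (realCyclo n)
    rw [hd, mul_comm d] at h
    exact Nat.eq_of_mul_eq_mul_left finrank_pos h
  refine pRank_eq_one_add hℓ (f := classNorm ↥(K₂ ⊔ Kl) (realCyclo n))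
    (classNorm_extendedHom ↥(K₂ ⊔ Kl) (realCyclo n)) (hdeg ▸ hndvd) ?_
  rw [hH, hK₂lcl, ← pow_succ', Nat.sub_add_cancel hm]

end PaperStmt
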